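/- Let n ≥ 1 and let φ : ℝⁿ → ℂ be a C^∞ function with ∫_{ℝⁿ} φ = 0 such that for every multi-index α there is a constant C_α with |∂^α φ(x)| ≤ C_α (1+‖x‖)^{-n-1/2-|α|} for all x. Set φ_t(x) = t^{-n} φ(x/t). Then for every 1 < p < ∞ there is a constant C_p such that for every Schwartz function f on ℝⁿ, ‖ (∫_0^∞ |(f ⋆ φ_t)(x)|² dt/t)^{1/2} ‖_{L^p(dx)} ≤ C_p ‖f‖_{L^p}. -/

import Mathlib

set_option linter.unusedSectionVars false
section
open MeasureTheory Set Metric Filter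
open scoped ENNReal NNReal Topology

namespace LPproof

/-- Pointwise layer cake formula. -/
theorem rpow_eq_lintegral (a : ℝ≥0∞) {p : ℝ} (hp : 0 < p) :
    a ^ p = ∫⁻ t in Ioi (0 : ℝ), ENNReal.ofReal (p * t ^ (p - 1)) *
      (if ENNReal.ofReal t < a then 1 else 0) := by
  have fin : ∀ b : ℝ, 0 ≤ b → ENNReal.ofReal b ^ p =
      ∫⁻ t in Ioi (0 : ℝ), ENNReal.ofReal (p * t ^ (p - 1)) *
      (if ENNReal.ofReal t < ENNReal.ofReal b then 1 else 0) := by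
    intro b hb
    have := lintegral_rpow_eq_lintegral_meas_lt_mul (Measure.dirac ()) (f := fun _ => b)
      (Eventually.of_forall fun _ => hb) aemeasurable_const hp
    rw [lintegral_dirac, ← lintegral_const_mul' _ _ ENNReal.ofReal_ne_top] at this
    rw [ENNReal.ofReal_rpow_of_nonneg hb hp.le, this]
    refine setLIntegral_congr_fun measurableSet_Ioi fun t ht => ?_
    rw [ENNReal.ofReal_mul hp.le]
    have ht : (0 : ℝ) < t := ht
    by_cases h : t < b
    · have : ENNReal.ofReal t < ENNReal.ofReal b :=
        (ENNReal.ofReal_lt_ofReal_iff (ht.trans h)).2 h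
      simp [h, this]
    · have : ¬ ENNReal.ofReal t < ENNReal.ofReal b := by
        rw [not_lt]; exact ENNReal.ofReal_le_ofReal (not_lt.1 h)
      simp [h, this]
  rcases eq_or_ne a ⊤ with rfl | ha
  · rw [ENNReal.top_rpow_of_pos hp]
    symm
    refine ENNReal.eq_top_of_forall_nnreal_le fun r => ?_
    calc (r : ℝ≥0∞) = ENNReal.ofReal ((r : ℝ) ^ (1 / p)) ^ p := by
          rw [ENNReal.ofReal_rpow_of_nonneg (by positivity) hp.le, ← Real.rpow_mul (by positivity)]
          simp [hp.ne']
      _ ≤ _ := by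
          rw [fin _ (by positivity)]
          gcongr with t
          split_ifs <;> simp_all
  · lift a to ℝ≥0 using ha
    simpa using fin a a.2

theorem layer_cake {α : Type*} [MeasurableSpace α] {μ : Measure α} [SFinite μ] {g : α → ℝ≥0∞}
    (hg : Measurable g) {p : ℝ} (hp : 0 < p) :
    ∫⁻ x, g x ^ p ∂μ = ∫⁻ t in Ioi (0 : ℝ), ENNReal.ofReal (p * t ^ (p - 1)) *
      μ {x | ENNReal.ofReal t < g x} := by
  simp_rw [fun x => rpow_eq_lintegral (g x) hp]
  rw [lintegral_lintegral_swap]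
  · congr with t
    rw [lintegral_const_mul' _ _ ENNReal.ofReal_ne_top]
    congr 1
    have hm : MeasurableSet {x | ENNReal.ofReal t < g x} := measurableSet_lt measurable_const hg
    rw [← lintegral_indicator_one hm]
    refine lintegral_congr fun x => ?_
    by_cases h : ENNReal.ofReal t < g x <;> simp [h]
  · refine Measurable.aemeasurable ?_
    refine Measurable.mul (by fun_prop) (Measurable.ite ?_ measurable_const measurable_const)
    exact measurableSet_lt (by fun_prop) (by fun_prop)

variable {E : Type*} [NormedAddCommGroup E] [InnerProductSpace ℝ E] [FiniteDimensional ℝ E]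
  [MeasurableSpace E] [BorelSpace E]

/-- The uncentered Hardy–Littlewood maximal function. -/
noncomputable def HLM (f : E → ℝ≥0∞) (x : E) : ℝ≥0∞ :=
  ⨆ (c : E) (r : ℝ) (_ : 0 < r),
    (ball c r).indicator (fun _ => (volume (ball c r))⁻¹ * ∫⁻ y in ball c r, f y) x

theorem lsc_HLM (f : E → ℝ≥0∞) : LowerSemicontinuous (HLM f) := by
  unfold HLM
  refine lowerSemicontinuous_iSup fun c => lowerSemicontinuous_iSup fun r =>
    lowerSemicontinuous_iSup fun hr => ?_
  exact isOpen_ball.lowerSemicontinuous_indicator zero_le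

theorem isOpen_HLM (f : E → ℝ≥0∞) (l : ℝ≥0∞) : IsOpen {x | l < HLM f x} :=
  (lsc_HLM f).isOpen_preimage l

theorem measurable_HLM (f : E → ℝ≥0∞) : Measurable (HLM f) := (lsc_HLM f).measurable

theorem avg_le_HLM (f : E → ℝ≥0∞) {x c : E} {r : ℝ} (hx : x ∈ ball c r) :
    (volume (ball c r))⁻¹ * ∫⁻ y in ball c r, f y ≤ HLM f x := by
  have hr : 0 < r := (dist_nonneg.trans_lt hx)
  unfold HLM
  refine le_trans ?_ (le_iSup₂ (f := fun c r => ⨆ (_ : 0 < r),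
    (ball c r).indicator (fun _ => (volume (ball c r))⁻¹ * ∫⁻ y in ball c r, f y) x) c r)
  simp [hr, indicator_of_mem hx]

theorem setLIntegral_le_HLM (f : E → ℝ≥0∞) {x c : E} {r : ℝ} (hx : x ∈ ball c r) :
    ∫⁻ y in ball c r, f y ≤ HLM f x * volume (ball c r) := by
  have hr : 0 < r := (dist_nonneg.trans_lt hx)
  have h := avg_le_HLM f hx
  have h0 : volume (ball c r) ≠ 0 := (measure_ball_pos _ _ hr).ne'
  have h1 : volume (ball c r) ≠ ⊤ := measure_ball_lt_top.ne
  calc ∫⁻ y in ball c r, f y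
      = ((volume (ball c r))⁻¹ * ∫⁻ y in ball c r, f y) * volume (ball c r) := by
        rw [mul_comm, ← mul_assoc, ENNReal.mul_inv_cancel h0 h1, one_mul]
    _ ≤ _ := by gcongr

theorem le_HLM {f : E → ℝ≥0∞} (hf : Continuous f) (x : E) : f x ≤ HLM f x := by
  refine le_of_forall_lt_imp_le_of_dense fun a ha => ?_
  obtain ⟨r, hr, hb⟩ := Metric.mem_nhds_iff.1 ((hf.tendsto x).eventually (lt_mem_nhds ha))
  refine le_trans ?_ (avg_le_HLM f (mem_ball_self hr))
  have h0 : volume (ball x r) ≠ 0 := (measure_ball_pos _ _ hr).ne'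
  have h1 : volume (ball x r) ≠ ⊤ := measure_ball_lt_top.ne
  calc a = (volume (ball x r))⁻¹ * ∫⁻ y in ball x r, a := by
        rw [setLIntegral_const, mul_comm, mul_assoc, ENNReal.mul_inv_cancel h0 h1, mul_one]
    _ ≤ _ := by
        gcongr 1
        exact setLIntegral_mono' measurableSet_ball fun y hy => (hb hy).le

theorem lt_HLM_iff {f : E → ℝ≥0∞} {x : E} {l : ℝ≥0∞} :
    l < HLM f x ↔ ∃ c : E, ∃ r : ℝ, x ∈ ball c r ∧
      l < (volume (ball c r))⁻¹ * ∫⁻ y in ball c r, f y := by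
  constructor
  · intro h
    unfold HLM at h
    simp only [lt_iSup_iff] at h
    obtain ⟨c, r, hr, h⟩ := h
    by_cases hx : x ∈ ball c r
    · rw [indicator_of_mem hx] at h
      exact ⟨c, r, hx, h⟩
    · rw [indicator_of_notMem hx] at h
      simp at h
  · rintro ⟨c, r, hx, h⟩
    exact h.trans_le (avg_le_HLM f hx)

theorem volume_ball_eq [Nontrivial E] (c : E) {r : ℝ} (hr : 0 ≤ r) :
    volume (ball c r) = ENNReal.ofReal r ^ Module.finrank ℝ E * volume (ball (0 : E) 1) := by
  rw [Measure.addHaar_ball _ _ hr, ENNReal.ofReal_pow hr]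

theorem HLM_weak [Nontrivial E] {f : E → ℝ≥0∞} (hf : ∫⁻ x, f x ≠ ⊤) {l : ℝ≥0∞} (hl : l ≠ 0) :
    l * volume {x | l < HLM f x} ≤ 5 ^ Module.finrank ℝ E * ∫⁻ x, f x := by
  rcases eq_or_ne l ⊤ with rfl | hlt
  · simp
  set d := Module.finrank ℝ E
  have hd : d ≠ 0 := Module.finrank_pos.ne'
  set v := volume (ball (0 : E) 1)
  have hv0 : v ≠ 0 := (measure_ball_pos _ _ one_pos).ne'
  have hv1 : v ≠ ⊤ := measure_ball_lt_top.ne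
  let t : Set (E × ℝ) := {q | 0 < q.2 ∧ l < (volume (ball q.1 q.2))⁻¹ * ∫⁻ y in ball q.1 q.2, f y}
  have key : ∀ q ∈ t, l * volume (ball q.1 q.2) ≤ ∫⁻ y in ball q.1 q.2, f y := by
    intro q hq
    have h0 : volume (ball q.1 q.2) ≠ 0 := (measure_ball_pos _ _ hq.1).ne'
    have h1 : volume (ball q.1 q.2) ≠ ⊤ := measure_ball_lt_top.ne
    have := hq.2.le
    rw [mul_comm, ← div_eq_mul_inv, ENNReal.le_div_iff_mul_le (.inl h0) (.inl h1)] at this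
    exact this
  have hR : ∃ R : ℝ, ∀ q ∈ t, q.2 ≤ R := by
    set J := (∫⁻ x, f x) / (l * v)
    have hJ : J ≠ ⊤ := ENNReal.div_ne_top hf (mul_ne_zero hl hv0)
    refine ⟨max 1 J.toReal, fun q hq => ?_⟩
    rcases le_or_gt q.2 1 with h1 | h1
    · exact h1.trans (le_max_left _ _)
    refine le_trans ?_ (le_max_right _ _)
    have h2 := (key q hq).trans (setLIntegral_le_lintegral _ _)
    rw [volume_ball_eq _ hq.1.le, mul_left_comm] at h2
    have h3 : ENNReal.ofReal q.2 ^ d ≤ J := by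
      rw [ENNReal.le_div_iff_mul_le (.inl (mul_ne_zero hl hv0)) (.inl (ENNReal.mul_ne_top hlt hv1))]
      exact h2
    have h4 : ENNReal.ofReal q.2 ≤ J := le_trans
      (le_self_pow (by simpa using h1.le) hd) h3
    exact (ENNReal.ofReal_le_iff_le_toReal hJ).1 h4
  obtain ⟨R, hR⟩ := hR
  obtain ⟨u, hut, hdis, hcov⟩ := Vitali.exists_disjoint_subfamily_covering_enlargement_ball t
    (fun q => q.1) (fun q => q.2) R hR 5 (by norm_num)
  have hcount : u.Countable := by
    refine hdis.countable_of_isOpen (fun _ _ => isOpen_ball) ?_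
    intro q hq
    exact ⟨q.1, mem_ball_self (hut hq).1⟩
  have hsub : {x | l < HLM f x} ⊆ ⋃ q ∈ u, ball q.1 (5 * q.2) := by
    intro x hx
    obtain ⟨c, r, hxc, h⟩ := lt_HLM_iff.1 hx
    obtain ⟨b, hb, hsub⟩ := hcov (c, r) ⟨dist_nonneg.trans_lt hxc, h⟩
    exact mem_biUnion hb (hsub hxc)
  calc l * volume {x | l < HLM f x}
      ≤ l * ∑' q : u, volume (ball q.1.1 (5 * q.1.2)) := by
        gcongr
        exact (measure_mono hsub).trans (measure_biUnion_le _ hcount _)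
    _ = ∑' q : u, 5 ^ d * (l * volume (ball q.1.1 q.1.2)) := by
        rw [← ENNReal.tsum_mul_left]
        congr with q
        have hq := (hut q.2).1
        rw [volume_ball_eq _ (by positivity), volume_ball_eq _ hq.le, ENNReal.ofReal_mul (by norm_num),
          mul_pow]
        simp only [ENNReal.ofReal_ofNat]
        ring
    _ ≤ ∑' q : u, 5 ^ d * ∫⁻ y in ball q.1.1 q.1.2, f y := by
        gcongr with q
        exact key _ (hut q.2)
    _ = 5 ^ d * ∫⁻ y in ⋃ q ∈ u, ball q.1 q.2, f y := by
        rw [ENNReal.tsum_mul_left, lintegral_biUnion hcount (fun _ _ => measurableSet_ball) hdis]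
    _ ≤ _ := by
        exact mul_le_mul_right (setLIntegral_le_lintegral _ _) _

theorem HLM_trunc (f : E → ℝ≥0∞) (hf : Measurable f) (t : ℝ≥0∞) (x : E) :
    HLM f x ≤ HLM ({y | t < f y}.indicator f) x + t := by
  refine le_of_forall_lt fun l hl => ?_
  obtain ⟨c, r, hx, h⟩ := lt_HLM_iff.1 hl
  refine h.trans_le ?_
  have hr : 0 < r := (dist_nonneg.trans_lt hx)
  have h0 : volume (ball c r) ≠ 0 := (measure_ball_pos _ _ hr).ne'
  have h1 : volume (ball c r) ≠ ⊤ := measure_ball_lt_top.ne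
  calc (volume (ball c r))⁻¹ * ∫⁻ y in ball c r, f y
      ≤ (volume (ball c r))⁻¹ * ∫⁻ y in ball c r, ({y | t < f y}.indicator f y + t) := by
        gcongr with y
        by_cases hy : t < f y
        · rw [indicator_of_mem (by exact hy)]; simp
        · rw [indicator_of_notMem (by exact hy)]; simpa using hy
    _ = (volume (ball c r))⁻¹ * (∫⁻ y in ball c r, {y | t < f y}.indicator f y) + t := by
        rw [lintegral_add_right _ measurable_const, mul_add, setLIntegral_const]
        congr 1
        rw [mul_comm, mul_assoc, ENNReal.mul_inv_cancel h0 h1, mul_one]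
    _ ≤ _ := by
        exact add_le_add_left (avg_le_HLM _ hx) _

theorem HLM_strong [Nontrivial E] {p : ℝ} (hp : 1 < p) : ∃ C : ℝ≥0∞, C ≠ ⊤ ∧
    ∀ f : E → ℝ≥0∞, Measurable f → ∫⁻ x, f x ≠ ⊤ →
      ∫⁻ x, HLM f x ^ p ≤ C * ∫⁻ x, f x ^ p := by
  set d := Module.finrank ℝ E
  refine ⟨2 * 5 ^ d * ENNReal.ofReal (p / (p - 1)) * 2 ^ (p - 1), ?_, ?_⟩
  · refine ENNReal.mul_ne_top (ENNReal.mul_ne_top (ENNReal.mul_ne_top (by simp) (by simp)) (by simp)) ?_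
    exact ENNReal.rpow_ne_top_of_nonneg (by linarith) (by simp)
  intro f hf hfi
  have hp0 : 0 < p - 1 := by linarith
  have step : ∀ t : ℝ, 0 < t → ENNReal.ofReal (p * t ^ (p - 1)) *
      volume {x | ENNReal.ofReal t < HLM f x} ≤ 2 * 5 ^ d * ENNReal.ofReal (p / (p - 1)) *
        ∫⁻ x, f x * (ENNReal.ofReal ((p - 1) * t ^ (p - 1 - 1)) *
          (if ENNReal.ofReal t < 2 * f x then 1 else 0)) := by
    intro t ht
    have hsub : {x | ENNReal.ofReal t < HLM f x} ⊆
        {x | ENNReal.ofReal (t / 2) < HLM ({y | ENNReal.ofReal (t / 2) < f y}.indicator f) x} := by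
      intro x hx
      by_contra hcon
      have h1 := HLM_trunc f hf (ENNReal.ofReal (t / 2)) x
      have h2 : HLM f x ≤ ENNReal.ofReal (t / 2) + ENNReal.ofReal (t / 2) :=
        h1.trans (by gcongr; exact not_lt.1 hcon)
      rw [← ENNReal.ofReal_add (by positivity) (by positivity), add_halves] at h2
      exact absurd hx (not_lt.2 h2)
    have hm : MeasurableSet {y | ENNReal.ofReal (t / 2) < f y} :=
      measurableSet_lt measurable_const hf
    have hw := HLM_weak (f := {y | ENNReal.ofReal (t / 2) < f y}.indicator f)
      (l := ENNReal.ofReal (t / 2))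
      (ne_top_of_le_ne_top hfi (lintegral_mono (indicator_le_self _ _)))
      (by simpa using ht)
    have hmul : ENNReal.ofReal (p * t ^ (p - 1)) =
        2 * ENNReal.ofReal (p / (p - 1)) * ENNReal.ofReal ((p - 1) * t ^ (p - 1 - 1)) *
          ENNReal.ofReal (t / 2) := by
      rw [← ENNReal.ofReal_ofNat, ← ENNReal.ofReal_mul (by positivity),
        ← ENNReal.ofReal_mul (by positivity), ← ENNReal.ofReal_mul (by positivity)]
      congr 1
      rw [Real.rpow_sub_one ht.ne' (p - 1)]
      field_simp
    calc _ ≤ 2 * ENNReal.ofReal (p / (p - 1)) * ENNReal.ofReal ((p - 1) * t ^ (p - 1 - 1)) *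
          (ENNReal.ofReal (t / 2) * volume {x | ENNReal.ofReal (t / 2) <
            HLM ({y | ENNReal.ofReal (t / 2) < f y}.indicator f) x}) := by
            rw [hmul, mul_assoc]; gcongr
      _ ≤ 2 * ENNReal.ofReal (p / (p - 1)) * ENNReal.ofReal ((p - 1) * t ^ (p - 1 - 1)) *
          (5 ^ d * ∫⁻ x, {y | ENNReal.ofReal (t / 2) < f y}.indicator f x) := by gcongr
      _ = 2 * 5 ^ d * ENNReal.ofReal (p / (p - 1)) *
          (ENNReal.ofReal ((p - 1) * t ^ (p - 1 - 1)) *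
            ∫⁻ x, {y | ENNReal.ofReal (t / 2) < f y}.indicator f x) := by ring
      _ = _ := by
          rw [← lintegral_const_mul' _ _ ENNReal.ofReal_ne_top]
          congr with x
          have : ENNReal.ofReal (t / 2) < f x ↔ ENNReal.ofReal t < 2 * f x := by
            rw [ENNReal.ofReal_div_of_pos two_pos, ENNReal.ofReal_ofNat,
              ENNReal.div_lt_iff (by simp) (by simp), mul_comm]
          by_cases hx : ENNReal.ofReal t < 2 * f x
          · rw [indicator_of_mem (by exact this.2 hx)]; rw [if_pos hx, mul_one, mul_comm]
          · rw [indicator_of_notMem (by exact fun h => hx (this.1 h))]; simp [hx]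
  rw [layer_cake (measurable_HLM f) (by linarith)]
  calc _ ≤ ∫⁻ t in Ioi (0 : ℝ), 2 * 5 ^ d * ENNReal.ofReal (p / (p - 1)) *
        ∫⁻ x, f x * (ENNReal.ofReal ((p - 1) * t ^ (p - 1 - 1)) *
          (if ENNReal.ofReal t < 2 * f x then 1 else 0)) :=
        setLIntegral_mono' measurableSet_Ioi step
    _ = 2 * 5 ^ d * ENNReal.ofReal (p / (p - 1)) * ∫⁻ t in Ioi (0 : ℝ),
        ∫⁻ x, f x * (ENNReal.ofReal ((p - 1) * t ^ (p - 1 - 1)) *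
          (if ENNReal.ofReal t < 2 * f x then 1 else 0)) := by
        rw [lintegral_const_mul']
        exact ENNReal.mul_ne_top (ENNReal.mul_ne_top (by simp) (by simp)) (by simp)
    _ = 2 * 5 ^ d * ENNReal.ofReal (p / (p - 1)) * ∫⁻ x, f x * (2 * f x) ^ (p - 1) := by
        rw [lintegral_lintegral_swap]
        · congr 2 with x
          rw [lintegral_const_mul, ← rpow_eq_lintegral _ hp0]
          refine Measurable.mul (by fun_prop) (Measurable.ite ?_ measurable_const measurable_const)
          exact measurableSet_lt (by fun_prop) (by fun_prop)
        · refine Measurable.aemeasurable ?_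
          refine Measurable.mul (by fun_prop) (Measurable.mul (by fun_prop)
            (Measurable.ite ?_ measurable_const measurable_const))
          exact measurableSet_lt (by fun_prop) (by fun_prop)
    _ = _ := by
        rw [mul_assoc _ (2 ^ (p - 1)) _, ← lintegral_const_mul' _ _
          (ENNReal.rpow_ne_top_of_nonneg hp0.le (by simp))]
        congr 2 with x
        rw [ENNReal.mul_rpow_of_nonneg _ _ hp0.le]
        have : f x ^ p = f x * f x ^ (p - 1) := by
          conv_lhs => rw [show p = 1 + (p - 1) by ring]
          rw [ENNReal.rpow_add_of_nonneg _ _ zero_le_one hp0.le, ENNReal.rpow_one]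
        rw [this]; ring

end LPproof
end

section
open MeasureTheory Set Metric Filter
open scoped ENNReal NNReal Topology FourierTransform ContDiff

namespace LPproof
variable {E : Type*} [NormedAddCommGroup E] [InnerProductSpace ℝ E] [FiniteDimensional ℝ E]
  [MeasurableSpace E] [BorelSpace E]

theorem plancherel {f : E → ℂ} (hf : Integrable f) (hf2 : MemLp f 2) :
    ∫⁻ ξ, ‖𝓕 f ξ‖ₑ ^ 2 = ∫⁻ x, ‖f x‖ₑ ^ 2 := by
  set F := hf2.toLp f with hF
  have hcont : Continuous (𝓕 f) :=
    VectorFourier.fourierIntegral_continuous Real.continuous_fourierChar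
      (by exact continuous_inner) hf
  have hae : (𝓕 F : Lp ℂ 2 (volume : Measure E)) =ᵐ[volume] 𝓕 f := by
    apply ae_eq_of_integral_contDiff_smul_eq
    · exact (Lp.memLp _).locallyIntegrable (by norm_num)
    · exact hcont.locallyIntegrable
    · intro g g_smooth g_cpt
      have hg₁ : HasCompactSupport (Complex.ofRealCLM ∘ g) := g_cpt.comp_left rfl
      have hg₂ : ContDiff ℝ ∞ (Complex.ofRealCLM ∘ g) := by fun_prop
      set G : SchwartzMap E ℂ := hg₁.toSchwartzMap hg₂ with hG
      have h1 : ∫ x, g x • (𝓕 F : Lp ℂ 2 (volume : Measure E)) x =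
          Lp.toTemperedDistribution (𝓕 F : Lp ℂ 2 (volume : Measure E)) G := by
        rw [Lp.toTemperedDistribution_apply]; simp [hG]
      rw [h1, ← Lp.fourier_toTemperedDistribution_eq, TemperedDistribution.fourier_apply,
        Lp.toTemperedDistribution_apply]
      have h2 : ∫ x, (𝓕 G) x • F x = ∫ x, (𝓕 G) x • f x := by
        apply integral_congr_ae
        filter_upwards [hf2.coeFn_toLp] with x hx
        rw [hx]
      rw [h2, SchwartzMap.fourier_coe]
      have h3 := VectorFourier.integral_fourierIntegral_smul_eq_flip (L := innerₗ E)
        (μ := volume) (ν := volume) (f := G) (g := f)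
        Real.continuous_fourierChar (by exact continuous_inner) G.integrable hf
      have h4 : ∫ x, (𝓕 (G : E → ℂ)) x • f x = ∫ x, G x • 𝓕 f x := by
        simpa [flip_innerₗ] using! h3
      rw [h4]
      simp [hG]
  have hn : ‖(𝓕 F : Lp ℂ 2 (volume : Measure E))‖ₑ = ‖F‖ₑ := by
    have := Lp.norm_fourier_eq F
    rw [← ofReal_norm, ← ofReal_norm, this]
  have key : eLpNorm (𝓕 f) 2 volume = eLpNorm f 2 volume := by
    rw [← eLpNorm_congr_ae hae, ← Lp.enorm_def, hn, hF, Lp.enorm_toLp]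
  rw [eLpNorm_eq_lintegral_rpow_enorm_toReal (by norm_num) (by norm_num),
    eLpNorm_eq_lintegral_rpow_enorm_toReal (by norm_num) (by norm_num)] at key
  have := congrArg (fun z => z ^ (2 : ℝ)) key
  simp only [← ENNReal.rpow_mul] at this
  simpa using this

theorem lintegral_rpow_le_of_bdd {α : Type*} [MeasurableSpace α] {μ : Measure α} {v : α → ℂ} {B : ℝ}
    (hB : ∀ x, ‖v x‖ ≤ B) {p : ℝ} (hp : 1 ≤ p) :
    ∫⁻ x, ‖v x‖ₑ ^ p ∂μ ≤ ENNReal.ofReal B ^ (p - 1) * ∫⁻ x, ‖v x‖ₑ ∂μ := by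
  rw [← lintegral_const_mul' _ _ (ENNReal.rpow_ne_top_of_nonneg (by linarith) (by simp))]
  refine lintegral_mono fun x => ?_
  have : ‖v x‖ₑ ^ p = ‖v x‖ₑ ^ (p - 1) * ‖v x‖ₑ := by
    conv_lhs => rw [show p = (p - 1) + 1 by ring]
    rw [ENNReal.rpow_add_of_nonneg _ _ (by linarith) zero_le_one, ENNReal.rpow_one]
  rw [this]
  gcongr
  rw [← ofReal_norm]
  exact ENNReal.ofReal_le_ofReal (hB x)

theorem lintegral_rpow_ne_top {α : Type*} [MeasurableSpace α] {μ : Measure α} {v : α → ℂ} {B : ℝ}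
    (hv : Integrable v μ) (hB : ∀ x, ‖v x‖ ≤ B) {p : ℝ} (hp : 1 ≤ p) :
    ∫⁻ x, ‖v x‖ₑ ^ p ∂μ ≠ ⊤ := by
  refine ne_top_of_le_ne_top ?_ (lintegral_rpow_le_of_bdd hB hp)
  exact ENNReal.mul_ne_top (ENNReal.rpow_ne_top_of_nonneg (by linarith) (by simp)) hv.2.ne

theorem memLp_two_of_bdd {α : Type*} [MeasurableSpace α] {μ : Measure α} {v : α → ℂ} {B : ℝ}
    (hv : Integrable v μ) (hB : ∀ x, ‖v x‖ ≤ B) : MemLp v 2 μ := by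
  refine ⟨hv.1, ?_⟩
  rw [eLpNorm_lt_top_iff_lintegral_rpow_enorm_lt_top (by norm_num) (by norm_num)]
  exact (lintegral_rpow_ne_top hv hB (by norm_num)).lt_top

/-- Convolution. -/
noncomputable def cv (f K : E → ℂ) (x : E) : ℂ := ∫ y, f y * K (x - y)

theorem cv_eq (f K : E → ℂ) :
    cv f K = convolution f K (ContinuousLinearMap.mul ℂ ℂ) volume := rfl

theorem integrable_cv {f K : E → ℂ} (hf : Integrable f) (hK : Integrable K) :
    Integrable (cv f K) := by
  rw [cv_eq]; exact hf.integrable_convolution _ hK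

theorem cv_bdd {f K : E → ℂ} {B : ℝ} (hfB : ∀ x, ‖f x‖ ≤ B) (hK : Integrable K) (x : E) :
    ‖cv f K x‖ ≤ B * ∫ y, ‖K y‖ := by
  unfold cv
  calc ‖∫ y, f y * K (x - y)‖ ≤ ∫ y, B * ‖K (x - y)‖ := by
        refine norm_integral_le_of_norm_le ((hK.comp_sub_left x).norm.const_mul B) ?_
        refine Eventually.of_forall fun y => ?_
        rw [norm_mul]
        gcongr
        exact hfB y
    _ = _ := by
        rw [integral_const_mul, integral_sub_left_eq_self (fun y => ‖K y‖)]

theorem l2_cv {f K : E → ℂ} {B : ℝ} (hf : Integrable f) (hfB : ∀ x, ‖f x‖ ≤ B)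
    (hK : Integrable K) :
    ∫⁻ x, ‖cv f K x‖ₑ ^ 2 = ∫⁻ ξ, ‖𝓕 f ξ‖ₑ ^ 2 * ‖𝓕 K ξ‖ₑ ^ 2 := by
  rw [← plancherel (integrable_cv hf hK)
    (memLp_two_of_bdd (integrable_cv hf hK) (cv_bdd hfB hK))]
  refine lintegral_congr fun ξ => ?_
  rw [cv_eq, Real.fourier_mul_convolution_eq hf hK, enorm_mul, mul_pow]

theorem measurable_fourier {f : E → ℂ} (hf : Integrable f) : Measurable (𝓕 f) :=
  (VectorFourier.fourierIntegral_continuous Real.continuous_fourierChar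
      (by exact continuous_inner) hf).measurable

/-- The square function associated with a family of kernels. -/
noncomputable def sqf {S : Type*} [MeasurableSpace S] (μ : Measure S) (K : S → E → ℂ)
    (f : E → ℂ) (x : E) : ℝ≥0∞ := ∫⁻ s, ‖cv f (K s) x‖ₑ ^ 2 ∂μ

theorem measurable_cv {S : Type*} [MeasurableSpace S] {K : S → E → ℂ} {f : E → ℂ}
    (hKm : Measurable (fun q : S × E => K q.1 q.2)) (hf : Measurable f) :
    Measurable (fun q : S × E => cv f (K q.1) q.2) := by
  refine StronglyMeasurable.measurable ?_
  unfold cv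
  refine StronglyMeasurable.integral_prod_right' (f := fun q : (S × E) × E => f q.2 * K q.1.1 (q.1.2 - q.2)) ?_
  refine Measurable.stronglyMeasurable ?_
  refine Measurable.mul (by fun_prop) ?_
  exact hKm.comp (f := fun q : (S × E) × E => (q.1.1, q.1.2 - q.2)) (by fun_prop)

theorem measurable_sqf {S : Type*} [MeasurableSpace S] {μ : Measure S} [SFinite μ]
    {K : S → E → ℂ} {f : E → ℂ}
    (hKm : Measurable (fun q : S × E => K q.1 q.2)) (hf : Measurable f) :
    Measurable (sqf μ K f) := by
  unfold sqf
  refine Measurable.lintegral_prod_left' (f := fun q : S × E => ‖cv f (K q.1) q.2‖ₑ ^ 2) ?_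
  exact (measurable_cv hKm hf).enorm.pow_const 2

theorem measurable_fourier_family {S : Type*} [MeasurableSpace S] {K : S → E → ℂ}
    (hKm : Measurable (fun q : S × E => K q.1 q.2)) :
    Measurable (fun q : S × E => 𝓕 (K q.1) q.2) := by
  refine StronglyMeasurable.measurable ?_
  simp only [Real.fourier_eq]
  refine StronglyMeasurable.integral_prod_right' (f := fun q : (S × E) × E =>
    Real.fourierChar (-(inner ℝ q.2 q.1.2)) • K q.1.1 q.2) ?_
  refine Measurable.stronglyMeasurable ?_
  simp only [Circle.smul_def, smul_eq_mul]
  refine Measurable.mul ?_ (hKm.comp (f := fun q : (S × E) × E => (q.1.1, q.2)) (by fun_prop))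
  have h1 : Continuous fun q : E × E => ((Real.fourierChar (-(inner ℝ q.2 q.1)) : Circle) : ℂ) := by
    have := Real.continuous_fourierChar
    fun_prop
  exact h1.measurable.comp (f := fun q : (S × E) × E => ((q.1.2, q.2) : E × E)) (by fun_prop)

theorem l2_sqf {S : Type*} [MeasurableSpace S] {μ : Measure S} [SFinite μ] {K : S → E → ℂ}
    (hKm : Measurable (fun q : S × E => K q.1 q.2)) (hKi : ∀ s, Integrable (K s)) {A : ℝ≥0∞}
    (hA : ∀ ξ, ∫⁻ s, ‖𝓕 (K s) ξ‖ₑ ^ 2 ∂μ ≤ A) {f : E → ℂ} {B : ℝ} (hfm : Measurable f)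
    (hf : Integrable f) (hfB : ∀ x, ‖f x‖ ≤ B) :
    ∫⁻ x, sqf μ K f x ≤ A * ∫⁻ x, ‖f x‖ₑ ^ 2 := by
  unfold sqf
  have hsw : AEMeasurable (Function.uncurry fun (x : E) (s : S) => ‖cv f (K s) x‖ₑ ^ 2)
      (volume.prod μ) :=
    (((measurable_cv hKm hfm).enorm.pow_const 2).comp measurable_swap).aemeasurable
  rw [lintegral_lintegral_swap hsw]
  simp_rw [fun s => l2_cv hf hfB (hKi s)]
  have hF := measurable_fourier hf
  have hKF := measurable_fourier_family hKm
  rw [lintegral_lintegral_swap]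
  · calc _ = ∫⁻ ξ, ‖𝓕 f ξ‖ₑ ^ 2 * ∫⁻ s, ‖𝓕 (K s) ξ‖ₑ ^ 2 ∂μ := by
          congr with ξ
          rw [lintegral_const_mul' _ _ (by simp)]
      _ ≤ ∫⁻ ξ, ‖𝓕 f ξ‖ₑ ^ 2 * A := by gcongr with ξ; exact hA ξ
      _ = _ := by
          rw [lintegral_mul_const _ (hF.enorm.pow_const 2), mul_comm,
            plancherel hf (memLp_two_of_bdd hf hfB)]
  · refine Measurable.aemeasurable (Measurable.mul ?_ (hKF.enorm.pow_const 2))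
    exact (hF.enorm.pow_const 2).comp measurable_snd

end LPproof
end

section
open MeasureTheory Set Metric Filter
open scoped ENNReal NNReal Topology FourierTransform ContDiff

namespace LPproof
variable {E : Type*} [NormedAddCommGroup E] [InnerProductSpace ℝ E] [FiniteDimensional ℝ E]
  [MeasurableSpace E] [BorelSpace E]

theorem cauchy_schwarz {S : Type*} [MeasurableSpace S] {μ : Measure S} {f g : S → ℝ≥0∞}
    (hf : AEMeasurable f μ) (hg : AEMeasurable g μ) {M N : ℝ≥0∞}
    (hM : ∫⁻ s, f s ^ 2 ∂μ ≤ M ^ 2) (hN : ∫⁻ s, g s ^ 2 ∂μ ≤ N ^ 2) :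
    ∫⁻ s, f s * g s ∂μ ≤ M * N := by
  have h := ENNReal.lintegral_mul_le_Lp_mul_Lq μ Real.HolderConjugate.two_two hf hg
  have key : ∀ {X Y : ℝ≥0∞}, X ≤ Y ^ 2 → X ^ (1 / (2:ℝ)) ≤ Y := by
    intro X Y h
    calc X ^ (1 / (2:ℝ)) ≤ (Y ^ 2) ^ (1 / (2:ℝ)) := by gcongr
      _ = Y := by
        rw [← ENNReal.rpow_natCast, ← ENNReal.rpow_mul]; norm_num
  calc _ ≤ _ := h
    _ ≤ M * N := by
      gcongr
      · exact key (by simpa using hM)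
      · exact key (by simpa using hN)

theorem minkowski_sq {S Y : Type*} [MeasurableSpace S] [MeasurableSpace Y] {μ : Measure S}
    [SFinite μ] {ν : Measure Y} [SFinite ν] {a M : Y → ℝ≥0∞} {D : S → Y → ℝ≥0∞}
    (ha : Measurable a) (hD : Measurable (fun q : S × Y => D q.1 q.2))
    (hMm : Measurable M) (hMf : ∀ y, M y ≠ ⊤) (hM : ∀ y, a y ≠ 0 → ∫⁻ s, D s y ^ 2 ∂μ ≤ M y ^ 2) :
    ∫⁻ s, (∫⁻ y, a y * D s y ∂ν) ^ 2 ∂μ ≤ (∫⁻ y, a y * M y ∂ν) ^ 2 := by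
  have hDy : ∀ y, Measurable fun s => D s y := fun y => hD.comp (by fun_prop : Measurable fun s => (s, y))
  have hDs : ∀ s, Measurable fun y => D s y := fun s => hD.comp (by fun_prop : Measurable fun y => (s, y))
  set G : S → ℝ≥0∞ := fun s => ∫⁻ y, a y * D s y ∂ν with hG
  have hGm : Measurable G :=
    Measurable.lintegral_prod_right' (f := fun q : S × Y => a q.2 * D q.1 q.2)
      ((ha.comp measurable_snd).mul hD)
  have step : ∀ H : S → ℝ≥0∞, Measurable H →
      ∫⁻ s, H s * G s ∂μ = ∫⁻ y, a y * ∫⁻ s, H s * D s y ∂μ ∂ν := by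
    intro H hH
    calc ∫⁻ s, H s * G s ∂μ = ∫⁻ s, ∫⁻ y, H s * (a y * D s y) ∂ν ∂μ := by
          refine lintegral_congr fun s => ?_
          exact (lintegral_const_mul _ (ha.mul (hDs s))).symm
      _ = ∫⁻ y, ∫⁻ s, H s * (a y * D s y) ∂μ ∂ν := by
          rw [lintegral_lintegral_swap]
          exact ((hH.comp measurable_fst).mul ((ha.comp measurable_snd).mul hD)).aemeasurable
      _ = _ := by
          refine lintegral_congr fun y => ?_
          refine Eq.trans ?_ (lintegral_const_mul _ (hH.mul (hDy y)))
          refine lintegral_congr fun s => ?_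
          ring
  have hin : ∀ y, a y ≠ 0 → ∫⁻ s, D s y * G s ∂μ ≤ M y * ∫⁻ y', a y' * M y' ∂ν := by
    intro y hy
    rw [step _ (hDy y)]
    rw [← lintegral_const_mul' _ _ (hMf y)]
    refine lintegral_mono fun y' => ?_
    rcases eq_or_ne (a y') 0 with h0 | h0
    · simp [h0]
    · calc a y' * ∫⁻ s, D s y * D s y' ∂μ ≤ a y' * (M y * M y') := by
            gcongr
            exact cauchy_schwarz (hDy y).aemeasurable (hDy y').aemeasurable (hM y hy) (hM y' h0)
        _ = _ := by ring
  calc ∫⁻ s, G s ^ 2 ∂μ = ∫⁻ s, G s * G s ∂μ := by simp_rw [sq]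
    _ = ∫⁻ y, a y * ∫⁻ s, G s * D s y ∂μ ∂ν := step G hGm
    _ ≤ ∫⁻ y, (a y * M y) * ∫⁻ y', a y' * M y' ∂ν ∂ν := by
        refine lintegral_mono fun y => ?_
        rcases eq_or_ne (a y) 0 with h0 | h0
        · simp [h0]
        · rw [mul_assoc]
          gcongr
          simpa [mul_comm] using hin y h0
    _ ≤ _ := by
        exact le_of_eq ((lintegral_mul_const _ (ha.mul hMm)).trans (sq _).symm)

theorem tail_bound [Nontrivial E] : ∃ C : ℝ≥0∞, C ≠ ⊤ ∧ ∀ δ : ℝ, 0 < δ →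
    ∫⁻ x in {x : E | δ ≤ ‖x‖}, ENNReal.ofReal ((‖x‖ ^ (Module.finrank ℝ E + 1))⁻¹)
      ≤ C * ENNReal.ofReal δ⁻¹ := by
  set d := Module.finrank ℝ E with hd
  set G : E → ℝ≥0∞ := fun x => {x : E | 1 ≤ ‖x‖}.indicator
      (fun x => ENNReal.ofReal ((‖x‖ ^ (d + 1))⁻¹)) x with hG
  have hGm : Measurable G := by
    refine Measurable.indicator (by fun_prop) ?_
    exact measurableSet_le measurable_const measurable_norm
  refine ⟨∫⁻ x, G x, ?_, ?_⟩
  · have h := finite_integral_one_add_norm (μ := (volume : Measure E)) (E := E) (r := d + 1) (by simp [hd])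
    refine ne_top_of_le_ne_top (ENNReal.mul_ne_top (a := ENNReal.ofReal (2 ^ (d+1))) (by simp) h.ne) ?_
    rw [← lintegral_const_mul' _ _ (by simp)]
    refine lintegral_mono fun x => ?_
    rw [hG]
    by_cases hx : x ∈ {x : E | 1 ≤ ‖x‖}
    · have hx' : 1 ≤ ‖x‖ := hx
      simp only [indicator_of_mem hx]
      rw [← ENNReal.ofReal_mul (by positivity)]
      refine ENNReal.ofReal_le_ofReal ?_
      rw [show (-((d:ℝ) + 1)) = -((d+1 : ℕ) : ℝ) by push_cast; ring, Real.rpow_neg (by positivity),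
        Real.rpow_natCast, ← div_eq_mul_inv, ← one_div, div_le_div_iff₀ (by positivity) (by positivity), one_mul, ← mul_pow]
      gcongr
      linarith
    · simp only [indicator_of_notMem hx]; exact zero_le
  · intro δ hδ
    have h1 := Measure.map_addHaar_smul (volume : Measure E) (r := δ⁻¹) (by positivity)
    have h2 : ∫⁻ x, G x ∂(Measure.map (fun x : E => δ⁻¹ • x) volume) = ∫⁻ x, G (δ⁻¹ • x) :=
      lintegral_map hGm (by fun_prop)
    rw [h1, lintegral_smul_measure, smul_eq_mul] at h2
    have hset : MeasurableSet {x : E | δ ≤ ‖x‖} := measurableSet_le measurable_const measurable_norm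
    have h3 : ∫⁻ x in {x : E | δ ≤ ‖x‖}, ENNReal.ofReal ((‖x‖ ^ (d + 1))⁻¹)
        = ENNReal.ofReal ((δ ^ (d+1))⁻¹) * ∫⁻ x, G (δ⁻¹ • x) := by
      rw [← lintegral_const_mul' _ _ (by simp), ← lintegral_indicator hset]
      refine lintegral_congr fun x => ?_
      have hiff : 1 ≤ ‖δ⁻¹ • x‖ ↔ δ ≤ ‖x‖ := by
        rw [norm_smul, norm_inv, Real.norm_of_nonneg hδ.le, ← div_eq_inv_mul, le_div_iff₀ hδ, one_mul]
      by_cases hx : δ ≤ ‖x‖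
      · rw [indicator_of_mem (by exact hx), hG]
        simp only
        rw [indicator_of_mem (by exact hiff.2 hx), ← ENNReal.ofReal_mul (by positivity)]
        congr 1
        rw [norm_smul, norm_inv, Real.norm_of_nonneg hδ.le, mul_pow, mul_inv, inv_pow, inv_inv, ← mul_assoc,
          inv_mul_cancel₀ (by positivity), one_mul]
      · rw [indicator_of_notMem (by exact hx), hG]
        simp only
        rw [indicator_of_notMem (by exact fun h => hx (hiff.1 h)), mul_zero]
    rw [h3, ← h2, ← mul_assoc, mul_comm]
    gcongr
    rw [← ENNReal.ofReal_mul (by positivity)]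
    refine ENNReal.ofReal_le_ofReal (le_of_eq ?_)
    rw [abs_of_nonneg (by positivity), inv_pow, inv_inv, pow_succ]
    rw [← hd]
    field_simp

end LPproof
end

section
open MeasureTheory Set Metric Filter
open scoped ENNReal NNReal Topology FourierTransform ContDiff

namespace LPproof
variable {E : Type*} [NormedAddCommGroup E] [InnerProductSpace ℝ E] [FiniteDimensional ℝ E]
  [MeasurableSpace E] [BorelSpace E]

open scoped Classical in
/-- averaging kernel over Whitney-type balls -/
noncomputable def whit (F : Set E) (y z : E) : ℝ≥0∞ :=
  if dist z y < infDist y F / 2 then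
    (ENNReal.ofReal (infDist y F / 2) ^ Module.finrank ℝ E * volume (ball (0 : E) 1))⁻¹ else 0

theorem vol_unit_ne_zero : volume (ball (0 : E) 1) ≠ 0 := (measure_ball_pos _ _ one_pos).ne'
theorem vol_unit_ne_top : volume (ball (0 : E) 1) ≠ ⊤ := measure_ball_lt_top.ne

theorem measurable_whit (F : Set E) : Measurable fun q : E × E => whit F q.1 q.2 := by
  unfold whit
  have h : Measurable fun q : E × E => infDist q.1 F := by
    have := (continuous_infDist_pt F).measurable
    fun_prop
  refine Measurable.ite ?_ ?_ measurable_const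
  · exact measurableSet_lt (by fun_prop) (by fun_prop)
  · fun_prop

theorem lintegral_whit [Nontrivial E] (F : Set E) {y : E} (hy : 0 < infDist y F) :
    ∫⁻ z, whit F y z = 1 := by
  have h : ∀ z, whit F y z = (ball y (infDist y F / 2)).indicator
      (fun _ => (ENNReal.ofReal (infDist y F / 2) ^ Module.finrank ℝ E * volume (ball (0 : E) 1))⁻¹) z := by
    intro z
    by_cases hz : dist z y < infDist y F / 2
    · rw [indicator_of_mem (by exact hz)]; simp [whit, hz]
    · rw [indicator_of_notMem (by exact hz)]; simp [whit, hz]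
  simp_rw [h]
  rw [lintegral_indicator measurableSet_ball, lintegral_const, Measure.restrict_apply_univ,
    volume_ball_eq y (r := infDist y F / 2) (by positivity)]
  refine ENNReal.inv_mul_cancel ?_ ?_
  · refine mul_ne_zero (pow_ne_zero _ ?_) vol_unit_ne_zero
    simpa using hy
  · exact ENNReal.mul_ne_top (by simp) vol_unit_ne_top

theorem whit_eq_zero_of_mem {F : Set E} {y z : E} (hz : z ∈ F) : whit F y z = 0 := by
  unfold whit
  rw [if_neg]
  have h1 : infDist y F ≤ dist y z := infDist_le_dist_of_mem hz
  have h2 := infDist_nonneg (x := y) (s := F)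
  rw [dist_comm] at h1
  linarith

theorem whit_eq_zero_of_infDist {F : Set E} {y z : E} (hz : infDist y F = 0) : whit F y z = 0 := by
  unfold whit
  rw [if_neg]
  rw [hz]
  simp

theorem whit_ne_top {F : Set E} {y z : E} : whit F y z ≠ ⊤ := by
  unfold whit
  split_ifs with h
  · have : 0 < infDist y F := by have := dist_nonneg (x := z) (y := y); linarith
    refine ENNReal.inv_ne_top.2 (mul_ne_zero (pow_ne_zero _ ?_) vol_unit_ne_zero)
    simpa using this
  · simp

theorem dist_lt_of_whit {F : Set E} {y z : E} (h : whit F y z ≠ 0) :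
    dist z y < infDist y F / 2 := by
  by_contra hc
  exact h (if_neg hc)

theorem whit_avg [Nontrivial E] {F : Set E} (hF : IsClosed F) (hne : F.Nonempty) {u : E → ℝ≥0∞}
    {t : ℝ≥0∞} (ht : ∀ x ∈ F, HLM u x ≤ t) (z : E) :
    ∫⁻ y, u y * whit F y z ≤ 6 ^ Module.finrank ℝ E * t * Fᶜ.indicator 1 z := by
  set d := Module.finrank ℝ E with hd
  by_cases hz : z ∈ F
  · simp [whit_eq_zero_of_mem hz]
  have hδ : 0 < infDist z F := (hF.notMem_iff_infDist_pos hne).1 hz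
  rw [indicator_of_mem (by exact hz), Pi.one_apply, mul_one]
  set c := ENNReal.ofReal (infDist z F / 3) ^ d * volume (ball (0 : E) 1) with hc
  have hc0 : c ≠ 0 := by
    refine mul_ne_zero (pow_ne_zero _ ?_) vol_unit_ne_zero
    simpa using hδ
  have hct : c ≠ ⊤ := ENNReal.mul_ne_top (by simp) vol_unit_ne_top
  have hpt : ∀ y, u y * whit F y z ≤ c⁻¹ * (ball z (2 * infDist z F)).indicator u y := by
    intro y
    by_cases h : whit F y z = 0
    · simp [h]
    have h1 := dist_lt_of_whit h
    have h2 : infDist y F ≤ infDist z F + dist y z := infDist_le_infDist_add_dist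
    have h3 : infDist z F ≤ infDist y F + dist z y := infDist_le_infDist_add_dist
    rw [dist_comm y z] at h2
    rw [indicator_of_mem, mul_comm]
    · gcongr
      unfold whit
      rw [if_pos h1, ENNReal.inv_le_inv, hc]
      have h4 : infDist z F / 3 ≤ infDist y F / 2 := by linarith
      gcongr
    · rw [mem_ball, dist_comm]
      linarith
  obtain ⟨x, hxF, hx⟩ := (infDist_lt_iff hne (x := z) (r := 2 * infDist z F)).1 (by linarith)
  calc ∫⁻ y, u y * whit F y z ≤ ∫⁻ y, c⁻¹ * (ball z (2 * infDist z F)).indicator u y :=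
        lintegral_mono hpt
    _ = c⁻¹ * ∫⁻ y in ball z (2 * infDist z F), u y := by
        rw [lintegral_const_mul' _ _ (ENNReal.inv_ne_top.2 hc0), lintegral_indicator measurableSet_ball]
    _ ≤ c⁻¹ * (t * volume (ball z (2 * infDist z F))) := by
        gcongr
        refine (setLIntegral_le_HLM u (x := x) (by rw [mem_ball, dist_comm]; exact hx)).trans ?_
        gcongr
        exact ht x hxF
    _ = c⁻¹ * (t * (6 ^ d * c)) := by
        rw [volume_ball_eq _ (by positivity), ← hd, hc, ← mul_assoc (6 ^ d)]
        congr 4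
        rw [← mul_pow]
        congr 1
        rw [show (6 : ℝ≥0∞) = ENNReal.ofReal 6 by simp, ← ENNReal.ofReal_mul (by norm_num)]
        congr 1
        ring
    _ = 6 ^ d * t * (c⁻¹ * c) := by ring
    _ ≤ _ := by rw [ENNReal.inv_mul_cancel hc0 hct, mul_one]

theorem lintegral_compl_le [Nontrivial E] {F : Set E} (hF : IsClosed F) (hne : F.Nonempty)
    {u : E → ℝ≥0∞} (hu : Measurable u)
    {t : ℝ≥0∞} (ht : ∀ x ∈ F, HLM u x ≤ t) :
    ∫⁻ y in Fᶜ, u y ≤ 6 ^ Module.finrank ℝ E * t * volume Fᶜ := by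
  have hw := measurable_whit F
  calc ∫⁻ y in Fᶜ, u y = ∫⁻ y, Fᶜ.indicator u y := (lintegral_indicator hF.measurableSet.compl _).symm
    _ ≤ ∫⁻ y, ∫⁻ z, u y * whit F y z := by
        refine lintegral_mono fun y => ?_
        by_cases hy : y ∈ F
        · simp [hy]
        · have hwy : Measurable fun z => whit F y z :=
            hw.comp (by fun_prop : Measurable fun z => (y, z))
          rw [lintegral_const_mul _ hwy,
            lintegral_whit F ((hF.notMem_iff_infDist_pos hne).1 hy), indicator_of_mem (by exact hy), mul_one]
    _ = ∫⁻ z, ∫⁻ y, u y * whit F y z := by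
        rw [lintegral_lintegral_swap]
        exact ((hu.comp measurable_fst).mul hw).aemeasurable
    _ ≤ ∫⁻ z, 6 ^ Module.finrank ℝ E * t * Fᶜ.indicator 1 z := lintegral_mono fun z => whit_avg hF hne ht z
    _ = _ := by
        rw [lintegral_const_mul _ (measurable_one.indicator hF.measurableSet.compl),
          lintegral_indicator_one hF.measurableSet.compl]

end LPproof
end

section
open MeasureTheory Set Metric Filter
open scoped ENNReal NNReal Topology FourierTransform ContDiff

namespace LPproof
variable {E : Type*} [NormedAddCommGroup E] [InnerProductSpace ℝ E] [FiniteDimensional ℝ E]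
  [MeasurableSpace E] [BorelSpace E]

/-- smoothed part of `f` -/
noncomputable def sm (F : Set E) (f : E → ℂ) (z : E) : ℂ := ∫ y, f y * ((whit F y z).toReal : ℂ)

theorem enorm_whit (F : Set E) (y z : E) : ‖((whit F y z).toReal : ℂ)‖ₑ = whit F y z := by
  rw [← ofReal_norm, Complex.norm_real, Real.norm_of_nonneg ENNReal.toReal_nonneg,
    ENNReal.ofReal_toReal whit_ne_top]

theorem measurable_sm (F : Set E) {f : E → ℂ} (hf : Measurable f) : Measurable (sm F f) := by
  refine StronglyMeasurable.measurable ?_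
  unfold sm
  refine StronglyMeasurable.integral_prod_right' (f := fun q : E × E => f q.2 * ((whit F q.2 q.1).toReal : ℂ)) ?_
  have := (measurable_whit F).comp (measurable_swap (α := E) (β := E))
  refine Measurable.stronglyMeasurable (Measurable.mul (by fun_prop) ?_)
  exact Complex.measurable_ofReal.comp (ENNReal.measurable_toReal.comp this)

theorem enorm_sm_le (F : Set E) (f : E → ℂ) (z : E) :
    ‖sm F f z‖ₑ ≤ ∫⁻ y, ‖f y‖ₑ * whit F y z := by
  unfold sm
  refine (enorm_integral_le_lintegral_enorm _).trans (le_of_eq ?_)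
  simp_rw [enorm_mul, enorm_whit]

theorem lintegral_whit_le [Nontrivial E] (F : Set E) (y : E) : ∫⁻ z, whit F y z ≤ 1 := by
  rcases (infDist_nonneg (x := y) (s := F)).eq_or_lt with h | h
  · simp [whit_eq_zero_of_infDist h.symm]
  · exact (lintegral_whit F h).le

theorem measurable_whit_right (F : Set E) (y : E) : Measurable fun z => whit F y z :=
  (measurable_whit F).comp (by fun_prop : Measurable fun z => (y, z))

theorem integrable_sm [Nontrivial E] (F : Set E) {f : E → ℂ} (hfm : Measurable f)
    (hf : Integrable f) : Integrable (sm F f) := by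
  refine ⟨(measurable_sm F hfm).aestronglyMeasurable, ?_⟩
  have hw := measurable_whit F
  calc ∫⁻ z, ‖sm F f z‖ₑ ≤ ∫⁻ z, ∫⁻ y, ‖f y‖ₑ * whit F y z := lintegral_mono fun z => enorm_sm_le F f z
    _ = ∫⁻ y, ∫⁻ z, ‖f y‖ₑ * whit F y z := by
        rw [lintegral_lintegral_swap]
        exact ((hfm.enorm.comp measurable_snd).mul (hw.comp measurable_swap)).aemeasurable
    _ ≤ ∫⁻ y, ‖f y‖ₑ := by
        refine lintegral_mono fun y => ?_
        rw [lintegral_const_mul _ (measurable_whit_right F y)]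
        exact mul_le_of_le_one_right zero_le (lintegral_whit_le F y)
    _ < ⊤ := hf.2

theorem cv_bad_le [Nontrivial E] {F : Set E} (hF : IsClosed F) (hne : F.Nonempty) {f : E → ℂ}
    (hfm : Measurable f) (hf : Integrable f) {K : E → ℂ} (hKm : Measurable K) {B : ℝ}
    (hK : ∀ x, ‖K x‖ ≤ B) (x : E) :
    ‖cv (fun y => Fᶜ.indicator f y - sm F f y) K x‖ₑ ≤
      ∫⁻ y, ‖f y‖ₑ * ∫⁻ z, whit F y z * ‖K (x - y) - K (x - z)‖ₑ := by
  have hw := measurable_whit F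
  set w : E → E → ℂ := fun y z => ((whit F y z).toReal : ℂ) with hwdef
  have hwm : Measurable fun q : E × E => w q.1 q.2 :=
    Complex.measurable_ofReal.comp (ENNReal.measurable_toReal.comp hw)
  have gen : ∀ κ : E × E → ℂ, Measurable κ → (∀ q, ‖κ q‖ ≤ B) →
      Integrable (fun q : E × E => f q.1 * w q.1 q.2 * κ q) (volume.prod volume) := by
    intro κ hκm hκ
    have hm : Measurable (fun q : E × E => f q.1 * w q.1 q.2 * κ q) :=
      ((hfm.comp measurable_fst).mul hwm).mul hκm
    refine ⟨hm.aestronglyMeasurable, ?_⟩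
    unfold HasFiniteIntegral
    rw [lintegral_prod _ hm.enorm.aemeasurable]
    calc ∫⁻ y, ∫⁻ z, ‖f y * w y z * κ (y, z)‖ₑ ≤ ∫⁻ y, ‖f y‖ₑ * ENNReal.ofReal B := by
          refine lintegral_mono fun y => ?_
          calc ∫⁻ z, ‖f y * w y z * κ (y, z)‖ₑ ≤ ∫⁻ z, (‖f y‖ₑ * ENNReal.ofReal B) * whit F y z := by
                refine lintegral_mono fun z => ?_
                simp only [enorm_mul, hwdef, enorm_whit]
                rw [mul_right_comm]
                gcongr
                rw [← ofReal_norm]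
                exact ENNReal.ofReal_le_ofReal (hκ _)
            _ ≤ _ := by
                rw [lintegral_const_mul _ (measurable_whit_right F y)]
                exact mul_le_of_le_one_right zero_le (lintegral_whit_le F y)
      _ = (∫⁻ y, ‖f y‖ₑ) * ENNReal.ofReal B := lintegral_mul_const _ hfm.enorm
      _ < ⊤ := ENNReal.mul_lt_top hf.2 (by simp)
  have i1 := gen (fun q => K (x - q.1)) (by fun_prop) (fun q => hK _)
  have i2 := gen (fun q => K (x - q.2)) (by fun_prop) (fun q => hK _)
  have e1 : ∫ y, Fᶜ.indicator f y * K (x - y) = ∫ y, ∫ z, f y * w y z * K (x - y) := by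
    refine integral_congr_ae (Eventually.of_forall fun y => ?_)
    have : ∀ z, f y * w y z * K (x - y) = (f y * K (x - y)) * w y z := fun z => by ring
    simp_rw [this]
    rw [integral_const_mul]
    have hwi : ∫ z, w y z = ((∫⁻ z, whit F y z).toReal : ℂ) := by
      rw [hwdef]
      rw [integral_complex_ofReal, integral_toReal (measurable_whit_right F y).aemeasurable
        (Eventually.of_forall fun z => whit_ne_top.lt_top)]
    rw [hwi]
    by_cases hy : y ∈ F
    · have : infDist y F = 0 := infDist_zero_of_mem hy
      simp [whit_eq_zero_of_infDist this, hy]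
    · rw [lintegral_whit F ((hF.notMem_iff_infDist_pos hne).1 hy), indicator_of_mem (by exact hy)]
      simp
  have e2 : ∫ z, sm F f z * K (x - z) = ∫ y, ∫ z, f y * w y z * K (x - z) := by
    rw [integral_integral_swap i2]
    refine integral_congr_ae (Eventually.of_forall fun z => ?_)
    simp only [sm]
    rw [← integral_mul_const]
  have j1 : Integrable fun y => Fᶜ.indicator f y * K (x - y) := by
    refine Integrable.mul_bdd (c := B) (hf.indicator hF.measurableSet.compl) ?_ (Eventually.of_forall fun y => hK _)
    exact Measurable.aestronglyMeasurable (by fun_prop)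
  have j2 : Integrable fun y => sm F f y * K (x - y) := by
    refine Integrable.mul_bdd (c := B) (integrable_sm F hfm hf) ?_ (Eventually.of_forall fun y => hK _)
    exact Measurable.aestronglyMeasurable (by fun_prop)
  have e3 : cv (fun y => Fᶜ.indicator f y - sm F f y) K x
      = ∫ y, ∫ z, f y * w y z * (K (x - y) - K (x - z)) := by
    unfold cv
    simp_rw [sub_mul]
    rw [integral_sub j1 j2, e1, e2, ← integral_sub i1.integral_prod_left i2.integral_prod_left]
    have h1 := i1.prod_right_ae
    have h2 := i2.prod_right_ae
    refine integral_congr_ae ?_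
    filter_upwards [h1, h2] with y hy1 hy2
    rw [← integral_sub hy1 hy2]
    simp_rw [mul_sub]
  rw [e3]
  refine (enorm_integral_le_lintegral_enorm _).trans ?_
  refine lintegral_mono fun y => ?_
  refine (enorm_integral_le_lintegral_enorm _).trans ?_
  rw [← lintegral_const_mul' _ _ enorm_ne_top]
  refine lintegral_mono fun z => ?_
  simp only [enorm_mul, hwdef, enorm_whit, mul_assoc]
  exact le_rfl

end LPproof
end

section
open MeasureTheory Set Metric Filter
open scoped ENNReal NNReal Topology FourierTransform ContDiff

namespace LPproof
variable {E : Type*} [NormedAddCommGroup E] [InnerProductSpace ℝ E] [FiniteDimensional ℝ E]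
  [MeasurableSpace E] [BorelSpace E]

/-- Square-function Calderon-Zygmund kernels with constant `A`. -/
structure CZK {S : Type*} [MeasurableSpace S] (μ : Measure S) (K : S → E → ℂ) (A : ℝ≥0∞) : Prop where
  meas : Measurable fun q : S × E => K q.1 q.2
  int : ∀ s, Integrable (K s)
  bdd : ∀ s, ∃ B : ℝ, ∀ x, ‖K s x‖ ≤ B
  four : ∀ ξ, ∫⁻ s, ‖𝓕 (K s) ξ‖ₑ ^ 2 ∂μ ≤ A
  reg : ∃ D : S → E → ℝ≥0∞, Measurable (fun q : S × E => D q.1 q.2) ∧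
    (∀ s x y, 2 * ‖y‖ ≤ ‖x‖ → ‖K s (x - y) - K s x‖ₑ ≤ ENNReal.ofReal ‖y‖ * D s x) ∧
    ∀ x, x ≠ 0 → ∫⁻ s, D s x ^ 2 ∂μ ≤
      (A * ENNReal.ofReal ((‖x‖ ^ (Module.finrank ℝ E + 1))⁻¹)) ^ 2

theorem cv_add {f g K : E → ℂ} {B : ℝ} (hf : Integrable f) (hg : Integrable g) (hKm : Measurable K)
    (hK : ∀ x, ‖K x‖ ≤ B) (x : E) : cv (fun y => f y + g y) K x = cv f K x + cv g K x := by
  unfold cv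
  simp_rw [add_mul]
  have h : ∀ {u : E → ℂ}, Integrable u → Integrable fun y => u y * K (x - y) := by
    intro u hu
    refine Integrable.mul_bdd (c := B) hu ?_ (Eventually.of_forall fun y => hK _)
    exact Measurable.aestronglyMeasurable (by fun_prop)
  exact integral_add (h hf) (h hg)

theorem enorm_add_sq_le (a b : ℂ) : ‖a + b‖ₑ ^ 2 ≤ 2 * ‖a‖ₑ ^ 2 + 2 * ‖b‖ₑ ^ 2 := by
  have h : ‖a + b‖ ^ 2 ≤ 2 * ‖a‖ ^ 2 + 2 * ‖b‖ ^ 2 := by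
    have h1 := norm_add_le a b
    have h2 := norm_nonneg (a + b)
    nlinarith [sq_nonneg (‖a‖ - ‖b‖)]
  have h' := ENNReal.ofReal_le_ofReal h
  rw [ENNReal.ofReal_add (by positivity) (by positivity), ENNReal.ofReal_mul (by norm_num),
    ENNReal.ofReal_mul (by norm_num)] at h'
  simpa [ENNReal.ofReal_pow, ofReal_norm] using h'

theorem bad_pointwise [Nontrivial E] {S : Type*} [MeasurableSpace S] {μ : Measure S} [SFinite μ]
    {K : S → E → ℂ} {A : ℝ≥0∞} (hA : A ≠ ⊤) (hK : CZK μ K A)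
    {F : Set E} (hF : IsClosed F) (hne : F.Nonempty) {f : E → ℂ}
    (hfm : Measurable f) (hf : Integrable f) {x : E} (hx : x ∈ F) :
    sqf μ K (fun y => Fᶜ.indicator f y - sm F f y) x ≤
      (∫⁻ y, (‖f y‖ₑ * ENNReal.ofReal (infDist y F)) *
        (A * ENNReal.ofReal ((‖x - y‖ ^ (Module.finrank ℝ E + 1))⁻¹))) ^ 2 := by
  obtain ⟨D, hDm, hD1, hD2⟩ := hK.reg
  have hinf : Measurable fun y => infDist y F := (continuous_infDist_pt F).measurable
  have hmem : ∀ y, infDist y F ≤ ‖x - y‖ := fun y => by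
    rw [← dist_eq_norm, dist_comm]; exact infDist_le_dist_of_mem hx
  refine le_trans ?_ (minkowski_sq (μ := μ) (ν := volume) (D := fun s y => D s (x - y))
    (a := fun y => ‖f y‖ₑ * ENNReal.ofReal (infDist y F)) (by fun_prop) ?_ (by fun_prop) ?_ ?_)
  · unfold sqf
    refine lintegral_mono fun s => ?_
    obtain ⟨B, hB⟩ := hK.bdd s
    have hKm : Measurable (K s) := hK.meas.comp (by fun_prop : Measurable fun x => (s, x))
    refine pow_le_pow_left₀ zero_le ((cv_bad_le hF hne hfm hf hKm hB x).trans ?_) 2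
    refine lintegral_mono fun y => ?_
    simp only [mul_assoc]
    gcongr
    calc ∫⁻ z, whit F y z * ‖K s (x - y) - K s (x - z)‖ₑ
        ≤ ∫⁻ z, whit F y z * (ENNReal.ofReal (infDist y F) * D s (x - y)) := by
          refine lintegral_mono fun z => ?_
          rcases eq_or_ne (whit F y z) 0 with h0 | h0
          · simp [h0]
          have h1 := dist_lt_of_whit h0
          rw [dist_eq_norm] at h1
          have h2 := hD1 s (x - y) (z - y) (by linarith [hmem y])
          rw [sub_sub_sub_cancel_right, enorm_sub_rev] at h2
          gcongr
          refine h2.trans ?_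
          gcongr
          linarith [norm_nonneg (z - y)]
      _ ≤ _ := by
          rw [lintegral_mul_const _ (measurable_whit_right F y)]
          exact mul_le_of_le_one_left zero_le (lintegral_whit_le F y)
  · exact hDm.comp (by fun_prop : Measurable fun q : S × E => (q.1, x - q.2))
  · intro y; exact ENNReal.mul_ne_top hA (by simp)
  · intro y hy
    refine hD2 (x - y) fun h0 => hy ?_
    have := hmem y
    rw [h0, norm_zero] at this
    simp [ENNReal.ofReal_of_nonpos this]

theorem weak_est [Nontrivial E] : ∃ Ct : ℝ≥0∞, Ct ≠ ⊤ ∧ ∀ (S : Type) [MeasurableSpace S]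
    (μ : Measure S) [SFinite μ]
    (K : S → E → ℂ) (A : ℝ≥0∞), A ≠ ⊤ → CZK μ K A → ∀ f : E → ℂ, Continuous f →
    Integrable f → (∃ B : ℝ, ∀ x, ‖f x‖ ≤ B) → ∀ t : ℝ, 0 < t →
    volume {x | ENNReal.ofReal (4 * t ^ 2) < sqf μ K f x} ≤
      (1 + A * Ct) * volume {x | ENNReal.ofReal t < HLM (fun y => ‖f y‖ₑ) x} +
        A * (ENNReal.ofReal (t ^ 2))⁻¹ * ∫⁻ x in {x | ‖f x‖ₑ ≤ ENNReal.ofReal t}, ‖f x‖ₑ ^ 2 := by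
  obtain ⟨C0, hC0, htail⟩ := tail_bound (E := E)
  set d := Module.finrank ℝ E with hd
  refine ⟨(6 ^ d) ^ 2 + C0 * 6 ^ d, ?_, ?_⟩
  · exact ENNReal.add_ne_top.2 ⟨by simp, ENNReal.mul_ne_top hC0 (by simp)⟩
  intro S _ μ _ K A hA hK f hfc hf ⟨B, hfB⟩ t ht
  have hfm := hfc.measurable
  set T := ENNReal.ofReal t with hT
  have hT0 : T ≠ 0 := by simpa [hT] using ht
  have hTt : T ≠ ⊤ := by simp [hT]
  have hT2 : ENNReal.ofReal (t ^ 2) = T ^ 2 := by rw [hT, ENNReal.ofReal_pow ht.le]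
  set u : E → ℝ≥0∞ := fun y => ‖f y‖ₑ with hu
  have hum : Measurable u := hfm.enorm
  set Ω := {x | T < HLM u x} with hΩ
  have hΩo : IsOpen Ω := isOpen_HLM u T
  set F := Ωᶜ with hFdef
  have hF : IsClosed F := hΩo.isClosed_compl
  have hFc : Fᶜ = Ω := compl_compl _
  have hFt : ∀ x ∈ F, HLM u x ≤ T := fun x hx => not_lt.1 hx
  rcases F.eq_empty_or_nonempty with hne | hne
  · have : Ω = univ := by rw [← hFc, hne, compl_empty]
    rw [this]
    refine le_trans (le_trans (measure_mono (subset_univ _)) ?_) le_self_add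
    exact le_mul_of_one_le_left zero_le le_self_add
  -- good and bad parts
  set g : E → ℂ := fun y => F.indicator f y + sm F f y with hg
  set b : E → ℂ := fun y => Fᶜ.indicator f y - sm F f y with hb
  have hsm := measurable_sm F hfm
  have hsi := integrable_sm F hfm hf
  have hgi : Integrable g := (hf.indicator hF.measurableSet).add hsi
  have hbi : Integrable b := (hf.indicator hF.measurableSet.compl).sub hsi
  have hgm : Measurable g := (hfm.indicator hF.measurableSet).add hsm
  have hbm : Measurable b := (hfm.indicator hF.measurableSet.compl).sub hsm
  have hsb : ∀ z, ‖sm F f z‖ₑ ≤ 6 ^ d * T * Fᶜ.indicator 1 z := fun z =>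
    (enorm_sm_le F f z).trans (whit_avg hF hne hFt z)
  have hgB : ∃ B', ∀ x, ‖g x‖ ≤ B' := by
    refine ⟨B + (6 ^ d * T).toReal, fun x => (norm_add_le _ _).trans (add_le_add ?_ ?_)⟩
    · refine (norm_indicator_le_norm_self _ _).trans (hfB x)
    · have h1 : ‖sm F f x‖ₑ ≤ 6 ^ d * T :=
        (hsb x).trans (mul_le_of_le_one_right zero_le (indicator_le_self' (by simp) x))
      have h2 := ENNReal.toReal_mono (ENNReal.mul_ne_top (by simp) hTt) h1
      simpa using h2
  obtain ⟨B', hgB⟩ := hgB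
  have hsum : ∀ y, f y = g y + b y := by
    intro y
    have := congrFun (indicator_self_add_compl F f) y
    simp only [Pi.add_apply] at this
    rw [hg, hb]
    simp only
    rw [← this]
    ring
  have hpt : ∀ x, sqf μ K f x ≤ 2 * sqf μ K g x + 2 * sqf μ K b x := by
    intro x
    unfold sqf
    have mg : Measurable fun s => ‖cv g (K s) x‖ₑ ^ 2 :=
      ((measurable_cv hK.meas hgm).comp (by fun_prop : Measurable fun s => (s, x))).enorm.pow_const 2
    have mb : Measurable fun s => ‖cv b (K s) x‖ₑ ^ 2 :=
      ((measurable_cv hK.meas hbm).comp (by fun_prop : Measurable fun s => (s, x))).enorm.pow_const 2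
    rw [← lintegral_const_mul _ mg, ← lintegral_const_mul _ mb, ← lintegral_add_left (mg.const_mul 2)]
    refine lintegral_mono fun s => ?_
    obtain ⟨BK, hBK⟩ := hK.bdd s
    have hKm : Measurable (K s) := hK.meas.comp (by fun_prop : Measurable fun x => (s, x))
    have : cv f (K s) x = cv g (K s) x + cv b (K s) x := by
      rw [← cv_add hgi hbi hKm hBK]
      congr 1
      funext y; exact hsum y
    simp only [this]
    exact enorm_add_sq_le _ _
  set W : E → ℝ≥0∞ := fun x => ∫⁻ y, (‖f y‖ₑ * ENNReal.ofReal (infDist y F)) *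
        (A * ENNReal.ofReal ((‖x - y‖ ^ (d + 1))⁻¹)) with hW
  have hinf : Measurable fun y => infDist y F := (continuous_infDist_pt F).measurable
  have hWm2 : Measurable fun q : E × E => (‖f q.2‖ₑ * ENNReal.ofReal (infDist q.2 F)) *
        (A * ENNReal.ofReal ((‖q.1 - q.2‖ ^ (d + 1))⁻¹)) := by fun_prop
  have hWm : Measurable W := hWm2.lintegral_prod_right'
  have hWF : ∀ x ∈ F, sqf μ K b x ≤ W x ^ 2 := fun x hx => bad_pointwise hA hK hF hne hfm hf hx
  have hsub : {x | ENNReal.ofReal (4 * t ^ 2) < sqf μ K f x} ⊆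
      (Ω ∪ {x | T ^ 2 ≤ sqf μ K g x}) ∪ {x | T ≤ F.indicator W x} := by
    intro x hx
    by_contra hc
    simp only [mem_union, mem_ofPred_eq, not_or, not_le] at hc
    obtain ⟨⟨h1, h2⟩, h3⟩ := hc
    have hxF : x ∈ F := h1
    rw [indicator_of_mem hxF] at h3
    have h4 : sqf μ K b x ≤ T ^ 2 := (hWF x hxF).trans (pow_le_pow_left₀ zero_le h3.le 2)
    have h5 : ENNReal.ofReal (4 * t ^ 2) < sqf μ K f x := hx
    refine absurd h5 (not_lt.2 ?_)
    refine (hpt x).trans ?_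
    calc 2 * sqf μ K g x + 2 * sqf μ K b x ≤ 2 * T ^ 2 + 2 * T ^ 2 := by gcongr
      _ = 4 * T ^ 2 := by ring
      _ = _ := by rw [ENNReal.ofReal_mul (by norm_num), hT2]; simp
  -- L2 bound for g
  have hg2 : ∫⁻ x, ‖g x‖ₑ ^ 2 ≤ (∫⁻ x in {x | u x ≤ T}, u x ^ 2) + (6 ^ d * T) ^ 2 * volume Ω := by
    have hms : MeasurableSet {x | u x ≤ T} := measurableSet_le hum measurable_const
    calc ∫⁻ x, ‖g x‖ₑ ^ 2 ≤ ∫⁻ x, ({x | u x ≤ T}.indicator (fun x => u x ^ 2) x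
            + (6 ^ d * T) ^ 2 * Ω.indicator 1 x) := by
          refine lintegral_mono fun x => ?_
          by_cases hx : x ∈ F
          · have h0 : sm F f x = 0 := by
              have := hsb x
              rw [indicator_of_notMem (by simpa using hx), mul_zero] at this
              simpa using this
            have hxu : x ∈ {x | u x ≤ T} := (le_HLM hfc.enorm x).trans (hFt x hx)
            simp only [hg, h0, indicator_of_mem hx, add_zero, indicator_of_mem hxu]
            exact le_self_add
          · have hxΩ : x ∈ Ω := by simpa [hFdef] using hx
            have hgx : g x = sm F f x := by simp [hg, indicator_of_notMem hx]
            rw [hgx]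
            refine le_trans ?_ le_add_self
            have := hsb x
            rw [hFc, indicator_of_mem hxΩ] at this
            rw [indicator_of_mem hxΩ]
            simp only [Pi.one_apply, mul_one] at this ⊢
            exact pow_le_pow_left₀ zero_le this 2
      _ = _ := by
          rw [lintegral_add_left ((hum.pow_const 2).indicator hms), lintegral_indicator hms,
            lintegral_const_mul _ (measurable_one.indicator hΩo.measurableSet),
            lintegral_indicator_one hΩo.measurableSet]
  have hgood : volume {x | T ^ 2 ≤ sqf μ K g x} ≤
      (A * ((∫⁻ x in {x | u x ≤ T}, u x ^ 2) + (6 ^ d * T) ^ 2 * volume Ω)) / T ^ 2 := by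
    refine (meas_ge_le_lintegral_div (measurable_sqf hK.meas hgm).aemeasurable
      (pow_ne_zero _ hT0) (by simp [hTt])).trans ?_
    gcongr
    refine (l2_sqf hK.meas hK.int hK.four hgm hgi hgB).trans ?_
    gcongr
  have hWint : ∫⁻ x, F.indicator W x ≤ A * C0 * (6 ^ d * T * volume Ω) := by
    rw [lintegral_indicator hF.measurableSet]
    calc ∫⁻ x in F, W x = ∫⁻ y, ∫⁻ x in F, (‖f y‖ₑ * ENNReal.ofReal (infDist y F)) *
          (A * ENNReal.ofReal ((‖x - y‖ ^ (d + 1))⁻¹)) := by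
          rw [hW, lintegral_lintegral_swap]
          exact hWm2.aemeasurable
      _ ≤ ∫⁻ y, Ω.indicator (fun y => A * C0 * u y) y := by
          refine lintegral_mono fun y => ?_
          rw [lintegral_const_mul _ (by fun_prop), lintegral_const_mul _ (by fun_prop)]
          by_cases hy : y ∈ F
          · rw [infDist_zero_of_mem hy]; simp
          have hyΩ : y ∈ Ω := by simpa [hFdef] using hy
          have hδ : 0 < infDist y F := (hF.notMem_iff_infDist_pos hne).1 hy
          rw [indicator_of_mem hyΩ]
          have h1 : ∫⁻ x in F, ENNReal.ofReal ((‖x - y‖ ^ (d + 1))⁻¹) ≤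
              C0 * ENNReal.ofReal (infDist y F)⁻¹ := by
            refine le_trans ?_ (htail _ hδ)
            rw [← lintegral_indicator hF.measurableSet,
              ← lintegral_indicator (measurableSet_le measurable_const measurable_norm),
              ← lintegral_sub_right_eq_self ({a : E | infDist y F ≤ ‖a‖}.indicator _) y]
            refine lintegral_mono fun x => ?_
            by_cases hx : x ∈ F
            · rw [indicator_of_mem hx, indicator_of_mem]
              change infDist y F ≤ ‖x - y‖
              rw [← dist_eq_norm, dist_comm]; exact infDist_le_dist_of_mem hx
            · rw [indicator_of_notMem hx]; exact zero_le
          calc _ ≤ ‖f y‖ₑ * ENNReal.ofReal (infDist y F) * (A * (C0 * ENNReal.ofReal (infDist y F)⁻¹)) := by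
                gcongr
            _ = A * C0 * u y * (ENNReal.ofReal (infDist y F) * ENNReal.ofReal (infDist y F)⁻¹) := by
                simp only [hu]; ring
            _ = _ := by
                rw [← ENNReal.ofReal_mul hδ.le, mul_inv_cancel₀ hδ.ne', ENNReal.ofReal_one, mul_one]
      _ = A * C0 * ∫⁻ y in Ω, u y := by
          rw [lintegral_indicator hΩo.measurableSet, lintegral_const_mul _ hum]
      _ ≤ _ := by
          gcongr
          have := lintegral_compl_le hF hne hum hFt
          rwa [hFc] at this
  have hbad : volume {x | T ≤ F.indicator W x} ≤ (A * C0 * (6 ^ d * T * volume Ω)) / T := by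
    refine (meas_ge_le_lintegral_div (hWm.indicator hF.measurableSet).aemeasurable hT0 hTt).trans ?_
    gcongr
  refine (measure_mono hsub).trans ((measure_union_le _ _).trans ?_)
  refine (add_le_add (measure_union_le _ _) le_rfl).trans ?_
  refine (add_le_add (add_le_add le_rfl hgood) hbad).trans (le_of_eq ?_)
  rw [hT2]
  have c1 : T * T⁻¹ = 1 := ENNReal.mul_inv_cancel hT0 hTt
  have c2 : T ^ 2 * (T ^ 2)⁻¹ = 1 := ENNReal.mul_inv_cancel (pow_ne_zero _ hT0) (by simp [hTt])
  rw [div_eq_mul_inv, div_eq_mul_inv]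
  set I := ∫⁻ x in {x | u x ≤ T}, u x ^ 2
  calc volume Ω + A * (I + (6 ^ d * T) ^ 2 * volume Ω) * (T ^ 2)⁻¹ + A * C0 * (6 ^ d * T * volume Ω) * T⁻¹
      = volume Ω + A * (T ^ 2)⁻¹ * I + A * (6 ^ d) ^ 2 * volume Ω * (T ^ 2 * (T ^ 2)⁻¹)
        + A * C0 * 6 ^ d * volume Ω * (T * T⁻¹) := by ring
    _ = _ := by rw [c1, c2]; ring

end LPproof
end

section
open MeasureTheory Set Metric Filter
open scoped ENNReal NNReal Topology FourierTransform ContDiff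

namespace LPproof
variable {E : Type*} [NormedAddCommGroup E] [InnerProductSpace ℝ E] [FiniteDimensional ℝ E]
  [MeasurableSpace E] [BorelSpace E]

theorem tail_t {p : ℝ} (hp0 : 0 < p) (hp : p < 2) {a : ℝ} (ha : 0 < a) :
    ∫⁻ t in Ioi (0:ℝ), ENNReal.ofReal (p * t ^ (p - 1)) *
      ((ENNReal.ofReal (t ^ 2))⁻¹ * (if a ≤ t then ENNReal.ofReal (a ^ 2) else 0))
      ≤ ENNReal.ofReal (p / (2 - p)) * ENNReal.ofReal (a ^ p) := by
  have hi : IntegrableOn (fun t : ℝ => t ^ (p - 3)) (Ioi a) :=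
    integrableOn_Ioi_rpow_of_lt (by linarith) ha
  have hval := integral_Ioi_rpow_of_lt (a := p - 3) (by linarith) ha
  calc _ = ∫⁻ t in Ioi (0:ℝ), (Ici a).indicator
        (fun t => ENNReal.ofReal (p * a ^ 2) * ENNReal.ofReal (t ^ (p - 3))) t := by
        refine setLIntegral_congr_fun measurableSet_Ioi fun t ht => ?_
        have ht : 0 < t := ht
        by_cases h : a ≤ t
        · rw [indicator_of_mem (by exact h)]
          simp only [if_pos h]
          rw [← ENNReal.ofReal_inv_of_pos (by positivity), ← ENNReal.ofReal_mul (by positivity),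
            ← ENNReal.ofReal_mul (by positivity), ← ENNReal.ofReal_mul (by positivity)]
          congr 1
          rw [show p - 1 = (p - 3) + 2 by ring, Real.rpow_add ht]
          norm_num
          field_simp
        · rw [indicator_of_notMem (by exact h)]
          simp [h]
    _ ≤ ∫⁻ t, (Ici a).indicator
        (fun t => ENNReal.ofReal (p * a ^ 2) * ENNReal.ofReal (t ^ (p - 3))) t :=
        setLIntegral_le_lintegral _ _
    _ = ∫⁻ t in Ioi a, ENNReal.ofReal (p * a ^ 2) * ENNReal.ofReal (t ^ (p - 3)) := by
        rw [lintegral_indicator measurableSet_Ici]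
        exact setLIntegral_congr Ioi_ae_eq_Ici.symm
    _ = ENNReal.ofReal (p * a ^ 2) * ENNReal.ofReal (∫ t in Ioi a, t ^ (p - 3)) := by
        rw [lintegral_const_mul' _ _ (by simp), ofReal_integral_eq_lintegral_ofReal hi]
        refine (ae_restrict_iff' measurableSet_Ioi).2 (Eventually.of_forall fun t ht => ?_)
        have ht : a < t := ht
        have : 0 < t := ha.trans ht
        simp only [Pi.zero_apply]
        positivity
    _ ≤ _ := by
        rw [hval, ← ENNReal.ofReal_mul (by positivity), ← ENNReal.ofReal_mul (div_nonneg hp0.le (by linarith))]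
        refine ENNReal.ofReal_le_ofReal (le_of_eq ?_)
        have h1 : a ^ p = a ^ (p - 3 + 1) * a ^ 2 := by
          rw [← Real.rpow_natCast a 2, ← Real.rpow_add ha]; congr 1; push_cast; ring
        rw [h1]
        have h2 : (2 - p) ≠ 0 := by linarith
        have h3 : p - 3 + 1 = -(2 - p) := by ring
        rw [h3]
        field_simp

theorem cz_lt_two [Nontrivial E] {p : ℝ} (hp1 : 1 < p) (hp2 : p < 2) {A : ℝ≥0∞} (hA : A ≠ ⊤) :
    ∃ C : ℝ≥0∞, C ≠ ⊤ ∧ ∀ (S : Type) [MeasurableSpace S] (μ : Measure S) [SFinite μ]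
    (K : S → E → ℂ), CZK μ K A → ∀ f : E → ℂ, Continuous f →
    Integrable f → (∃ B : ℝ, ∀ x, ‖f x‖ ≤ B) →
    ∫⁻ x, sqf μ K f x ^ (p / 2) ≤ C * ∫⁻ x, ‖f x‖ₑ ^ p := by
  obtain ⟨Ct, hCt, hweak⟩ := weak_est (E := E)
  obtain ⟨CM, hCM, hM⟩ := HLM_strong (E := E) hp1
  have hp0 : 0 < p := by linarith
  refine ⟨4 ^ (p / 2) * ((1 + A * Ct) * CM + A * ENNReal.ofReal (p / (2 - p))), ?_, ?_⟩
  · refine ENNReal.mul_ne_top (ENNReal.rpow_ne_top_of_nonneg (by positivity) (by simp)) ?_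
    refine ENNReal.add_ne_top.2 ⟨ENNReal.mul_ne_top (ENNReal.add_ne_top.2 ⟨by simp, ENNReal.mul_ne_top hA hCt⟩) hCM,
      ENNReal.mul_ne_top hA (by simp)⟩
  intro S _ μ _ K hK f hfc hf hfB
  have hfm := hfc.measurable
  have hsm := measurable_sqf (μ := μ) hK.meas hfm
  set g : E → ℝ≥0∞ := fun x => (sqf μ K f x / 4) ^ (1 / (2:ℝ)) with hg
  have hgm : Measurable g := by
    have : Measurable fun x => sqf μ K f x / 4 := hsm.div_const 4
    exact this.pow_const _
  have hgp : ∀ x, sqf μ K f x ^ (p / 2) = 4 ^ (p / 2) * g x ^ p := by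
    intro x
    rw [hg]
    simp only
    rw [← ENNReal.rpow_mul, show 1 / 2 * p = p / 2 by ring, ← ENNReal.mul_rpow_of_nonneg _ _ (by positivity),
      ENNReal.mul_div_cancel (by simp) (by simp)]
  have hset : ∀ t : ℝ, 0 < t → {x | ENNReal.ofReal t < g x} = {x | ENNReal.ofReal (4 * t ^ 2) < sqf μ K f x} := by
    intro t ht
    ext x
    change ENNReal.ofReal t < g x ↔ ENNReal.ofReal (4 * t ^ 2) < sqf μ K f x
    rw [hg]
    simp only
    rw [one_div, ENNReal.lt_rpow_inv_iff (by norm_num), ENNReal.lt_div_iff_mul_lt (by simp) (by simp)]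
    rw [ENNReal.ofReal_mul (by norm_num), ENNReal.ofReal_pow ht.le, mul_comm]
    simp
  have hHm := measurable_HLM (fun y => ‖f y‖ₑ)
  have hpm : Measurable fun t : ℝ => ENNReal.ofReal (p * t ^ (p - 1)) := by fun_prop
  have hms : ∀ t : ℝ, MeasurableSet {x | ‖f x‖ₑ ≤ ENNReal.ofReal t} := fun t =>
    measurableSet_le hfm.enorm measurable_const
  have hjm : Measurable fun q : ℝ × E => ENNReal.ofReal (p * q.1 ^ (p - 1)) *
          ((ENNReal.ofReal (q.1 ^ 2))⁻¹ * (if ‖f q.2‖ₑ ≤ ENNReal.ofReal q.1 then ‖f q.2‖ₑ ^ 2 else 0)) := by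
    refine Measurable.mul (by fun_prop) (Measurable.mul (by fun_prop) ?_)
    refine Measurable.ite (measurableSet_le (by fun_prop) (by fun_prop)) (by fun_prop) measurable_const
  have hsecond : ∫⁻ t in Ioi (0:ℝ), ENNReal.ofReal (p * t ^ (p - 1)) *
      ((ENNReal.ofReal (t ^ 2))⁻¹ * ∫⁻ x in {x | ‖f x‖ₑ ≤ ENNReal.ofReal t}, ‖f x‖ₑ ^ 2)
      ≤ ENNReal.ofReal (p / (2 - p)) * ∫⁻ x, ‖f x‖ₑ ^ p := by
    calc _ = ∫⁻ t in Ioi (0:ℝ), ∫⁻ x, ENNReal.ofReal (p * t ^ (p - 1)) *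
          ((ENNReal.ofReal (t ^ 2))⁻¹ * (if ‖f x‖ₑ ≤ ENNReal.ofReal t then ‖f x‖ₑ ^ 2 else 0)) := by
          refine setLIntegral_congr_fun measurableSet_Ioi fun t ht => ?_
          have hi : Measurable fun x => (if ‖f x‖ₑ ≤ ENNReal.ofReal t then ‖f x‖ₑ ^ 2 else 0) :=
            Measurable.ite (hms t) (by fun_prop) measurable_const
          have ht : 0 < t := ht
          rw [lintegral_const_mul _ (hi.const_mul _), lintegral_const_mul _ hi, ← lintegral_indicator (hms t)]
          congr 2
          refine lintegral_congr fun x => ?_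
          by_cases h : ‖f x‖ₑ ≤ ENNReal.ofReal t
          · rw [indicator_of_mem (by exact h), if_pos h]
          · rw [indicator_of_notMem (by exact h), if_neg h]
      _ = ∫⁻ x, ∫⁻ t in Ioi (0:ℝ), ENNReal.ofReal (p * t ^ (p - 1)) *
          ((ENNReal.ofReal (t ^ 2))⁻¹ * (if ‖f x‖ₑ ≤ ENNReal.ofReal t then ‖f x‖ₑ ^ 2 else 0)) := by
          rw [lintegral_lintegral_swap]
          exact hjm.aemeasurable
      _ ≤ ∫⁻ x, ENNReal.ofReal (p / (2 - p)) * ‖f x‖ₑ ^ p := by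
          refine lintegral_mono fun x => ?_
          rcases (norm_nonneg (f x)).eq_or_lt with h0 | h0
          · have : f x = 0 := norm_eq_zero.1 h0.symm
            simp [this]
          · have := tail_t hp0 hp2 h0
            rw [← ENNReal.ofReal_rpow_of_pos h0, ENNReal.ofReal_pow h0.le, ofReal_norm] at this
            refine le_trans (le_of_eq ?_) this
            refine setLIntegral_congr_fun measurableSet_Ioi fun t ht => ?_
            have ht : 0 < t := ht
            congr 3
            rw [← ofReal_norm, ENNReal.ofReal_le_ofReal_iff ht.le]
      _ = _ := lintegral_const_mul' _ _ (by simp)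
  simp_rw [hgp]
  rw [lintegral_const_mul _ (hgm.pow_const p), mul_assoc]
  gcongr
  rw [layer_cake hgm hp0]
  have hfirst : Measurable fun t : ℝ => ENNReal.ofReal (p * t ^ (p - 1)) *
      volume {x | ENNReal.ofReal t < HLM (fun y => ‖f y‖ₑ) x} := by
    refine hpm.mul ?_
    refine Antitone.measurable fun a b hab => measure_mono fun x hx => ?_
    exact lt_of_le_of_lt (ENNReal.ofReal_le_ofReal hab) hx
  calc ∫⁻ t in Ioi (0:ℝ), ENNReal.ofReal (p * t ^ (p - 1)) * volume {x | ENNReal.ofReal t < g x}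
      ≤ ∫⁻ t in Ioi (0:ℝ), ((1 + A * Ct) * (ENNReal.ofReal (p * t ^ (p - 1)) *
          volume {x | ENNReal.ofReal t < HLM (fun y => ‖f y‖ₑ) x}) +
        A * (ENNReal.ofReal (p * t ^ (p - 1)) *
      ((ENNReal.ofReal (t ^ 2))⁻¹ * ∫⁻ x in {x | ‖f x‖ₑ ≤ ENNReal.ofReal t}, ‖f x‖ₑ ^ 2))) := by
        refine setLIntegral_mono' measurableSet_Ioi fun t ht => ?_
        rw [hset t ht]
        refine (mul_le_mul_right (hweak S μ K A hA hK f hfc hf hfB t ht) _).trans (le_of_eq ?_)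
        ring
    _ ≤ (1 + A * Ct) * (CM * ∫⁻ x, ‖f x‖ₑ ^ p) + A * (ENNReal.ofReal (p / (2 - p)) * ∫⁻ x, ‖f x‖ₑ ^ p) := by
        rw [lintegral_add_left (hfirst.const_mul _), lintegral_const_mul _ hfirst, ← layer_cake hHm hp0,
          lintegral_const_mul' _ _ hA]
        gcongr
        exact hM _ hfm.enorm hf.2.ne
    _ = _ := by ring

end LPproof
end

section
open MeasureTheory Set Metric Filter
open scoped ENNReal NNReal Topology FourierTransform ContDiff

namespace LPproof
variable {E : Type*} [NormedAddCommGroup E] [InnerProductSpace ℝ E] [FiniteDimensional ℝ E]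
  [MeasurableSpace E] [BorelSpace E]

/-- the weight measuring off-diagonal decay -/
noncomputable def wt (r : ℝ) : ℝ := Real.exp (-|r| / 4)

theorem wt_pos (r : ℝ) : 0 < wt r := Real.exp_pos _

theorem wt_neg (r : ℝ) : wt (-r) = wt r := by simp [wt]

theorem continuous_wt : Continuous wt := by unfold wt; fun_prop

theorem wt_log_le_one {r : ℝ} (h0 : 0 < r) (h1 : r ≤ 1) : wt (Real.log r) = r ^ (1 / 4 : ℝ) := by
  rw [wt, Real.rpow_def_of_pos h0, abs_of_nonpos (Real.log_nonpos h0.le h1)]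
  congr 1; ring

theorem wt_log_one_le {r : ℝ} (h1 : 1 ≤ r) : wt (Real.log r) = r ^ (-(1 / 4) : ℝ) := by
  rw [wt, Real.rpow_def_of_pos (by linarith), abs_of_nonneg (Real.log_nonneg h1)]
  congr 1; ring

/-- Abstract properties of the generating kernel. -/
structure LPk (φ : E → ℂ) (C : ℝ) : Prop where
  cont : Continuous φ
  int : Integrable φ
  bdd : ∀ x, ‖φ x‖ ≤ C
  four0 : 𝓕 φ 0 = 0
  four : ∀ ξ, ξ ≠ 0 → ‖𝓕 φ ξ‖ ≤ C * wt (Real.log ‖ξ‖)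
  reg : ∀ x y, x ≠ 0 → 2 * ‖y‖ ≤ ‖x‖ →
    ‖φ (x - y) - φ x‖ ≤ C * ‖y‖ * (‖x‖ ^ (Module.finrank ℝ E + 1))⁻¹ * wt (Real.log ‖x‖)

theorem LPk.mono {φ : E → ℂ} {C C' : ℝ} (h : LPk φ C) (hC : C ≤ C') : LPk φ C' where
  cont := h.cont
  int := h.int
  bdd x := (h.bdd x).trans hC
  four0 := h.four0
  four ξ hξ := (h.four ξ hξ).trans (mul_le_mul_of_nonneg_right hC (wt_pos _).le)
  reg x y hx hy := (h.reg x y hx hy).trans (by have := wt_pos (Real.log ‖x‖); gcongr)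

theorem LPk.nonneg {φ : E → ℂ} {C : ℝ} (h : LPk φ C) : 0 ≤ C := (norm_nonneg _).trans (h.bdd 0)

theorem norm_char_sub_one (θ : ℝ) : ‖((Real.fourierChar θ : Circle) : ℂ) - 1‖ ≤ 2 * (2 * Real.pi * |θ|) ^ (1/4 : ℝ) := by
  have e : ((Real.fourierChar θ : Circle) : ℂ) = Complex.exp (Complex.I * ((2 * Real.pi * θ : ℝ) : ℂ)) := by
    rw [Real.fourierChar_apply, mul_comm]
  rw [e]
  have h1 := Real.norm_exp_I_mul_ofReal_sub_one_le (x := 2 * Real.pi * θ)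
  have h2 : ‖Complex.exp (Complex.I * ((2 * Real.pi * θ : ℝ) : ℂ)) - 1‖ ≤ 2 := by
    refine (norm_sub_le _ _).trans ?_
    rw [Complex.norm_exp_I_mul_ofReal]; norm_num
  have hab : ‖2 * Real.pi * θ‖ = 2 * Real.pi * |θ| := by
    rw [norm_mul, Real.norm_of_nonneg (by positivity), Real.norm_eq_abs]
  rw [hab] at h1
  set a := 2 * Real.pi * |θ|
  have ha : 0 ≤ a := by positivity
  rcases le_total a 1 with h | h
  · refine h1.trans ?_
    have : a ^ (1:ℝ) ≤ a ^ (1/4 : ℝ) := Real.rpow_le_rpow_of_exponent_ge' ha h (by norm_num) (by norm_num)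
    rw [Real.rpow_one] at this
    have h0 : 0 ≤ a ^ (1/4:ℝ) := by positivity
    linarith
  · refine h2.trans ?_
    have : 1 ≤ a ^ (1/4:ℝ) := Real.one_le_rpow h (by norm_num)
    linarith

theorem integrable_of_decay {F : Type*} [NormedAddCommGroup F] {g : E → F} (hg : Continuous g) {C r : ℝ}
    (hr : (Module.finrank ℝ E : ℝ) < r) (hb : ∀ x, ‖g x‖ ≤ C * (1 + ‖x‖) ^ (-r)) :
    Integrable g := by
  have := (integrable_one_add_norm (μ := (volume : Measure E)) hr).const_mul C
  exact this.mono' hg.aestronglyMeasurable (Eventually.of_forall hb)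

theorem four_small {φ : E → ℂ} (hc : Continuous φ) {C : ℝ}
    (hb : ∀ x, ‖φ x‖ ≤ C * (1 + ‖x‖) ^ (-((Module.finrank ℝ E : ℝ) + 1/2))) (hm : ∫ x, φ x = 0) :
    ∃ C' : ℝ, ∀ ξ : E, ‖𝓕 φ ξ‖ ≤ C' * ‖ξ‖ ^ (1/4 : ℝ) := by
  set d := Module.finrank ℝ E
  have hi : Integrable φ := integrable_of_decay hc (by linarith) hb
  have hj : Integrable fun x : E => C * (1 + ‖x‖) ^ (-((d : ℝ) + 1/4)) :=
    (integrable_one_add_norm (by linarith)).const_mul C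
  refine ⟨2 * (2 * Real.pi) ^ (1/4:ℝ) * ∫ x : E, C * (1 + ‖x‖) ^ (-((d : ℝ) + 1/4)), fun ξ => ?_⟩
  have h1 : 𝓕 φ ξ = ∫ x, (((Real.fourierChar (-(inner ℝ x ξ)) : Circle) : ℂ) - 1) * φ x := by
    have hk : Integrable fun x => ((Real.fourierChar (-(inner ℝ x ξ)) : Circle) : ℂ) * φ x := by
      refine Integrable.bdd_mul (c := 1) hi ?_ (Eventually.of_forall fun x => (Circle.norm_coe _).le)
      have := Real.continuous_fourierChar
      exact Continuous.aestronglyMeasurable (by fun_prop)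
    simp_rw [sub_mul, one_mul]
    rw [integral_sub hk hi, hm, sub_zero, Real.fourier_eq]
    simp_rw [Circle.smul_def, smul_eq_mul]
  rw [h1, ← integral_const_mul, ← integral_mul_const]
  refine norm_integral_le_of_norm_le ((hj.const_mul _).mul_const _) (Eventually.of_forall fun x => ?_)
  rw [norm_mul]
  have h2 := norm_char_sub_one (-(inner ℝ x ξ))
  have h3 : |(-(inner ℝ x ξ))| ≤ (1 + ‖x‖) * ‖ξ‖ := by
    rw [abs_neg]
    refine (abs_real_inner_le_norm x ξ).trans ?_
    gcongr
    linarith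
  calc _ ≤ (2 * (2 * Real.pi * ((1 + ‖x‖) * ‖ξ‖)) ^ (1/4 : ℝ)) * (C * (1 + ‖x‖) ^ (-((d : ℝ) + 1/2))) := by
        refine mul_le_mul (h2.trans ?_) (hb x) (norm_nonneg _) (by positivity)
        gcongr
    _ = _ := by
        rw [Real.mul_rpow (x := 2 * Real.pi) (by positivity) (by positivity),
          Real.mul_rpow (x := 1 + ‖x‖) (by positivity) (by positivity),
          show -((d : ℝ) + 1/4) = 1/4 + -((d : ℝ) + 1/2) by ring, Real.rpow_add (by positivity)]
        ring

theorem four_large {φ : E → ℂ} (hc : ContDiff ℝ 1 φ) (hi : Integrable φ) (hi' : Integrable (fderiv ℝ φ)) :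
    ∀ ξ : E, ξ ≠ 0 → ‖𝓕 φ ξ‖ ≤ (∫ x, ‖fderiv ℝ φ x‖) * ‖ξ‖⁻¹ := by
  intro ξ hξ
  have h1 := congrFun (Real.fourier_fderiv hi (hc.differentiable (by norm_num)) hi') ξ
  have h2 : ‖𝓕 (fderiv ℝ φ) ξ‖ ≤ ∫ x, ‖fderiv ℝ φ x‖ :=
    VectorFourier.norm_fourierIntegral_le_integral_norm _ _ _ _ _
  have h3 : ‖(𝓕 (fderiv ℝ φ) ξ) ξ‖ ≤ (∫ x, ‖fderiv ℝ φ x‖) * ‖ξ‖ :=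
    (ContinuousLinearMap.le_opNorm _ _).trans (by gcongr)
  have hn : 0 < ‖ξ‖ := norm_pos_iff.2 hξ
  have h4 : ‖(𝓕 (fderiv ℝ φ) ξ) ξ‖ = 2 * Real.pi * ‖ξ‖ ^ 2 * ‖𝓕 φ ξ‖ := by
    rw [h1, VectorFourier.fourierSMulRight_apply]
    have hin : ((-innerSL ℝ (E := E)) ξ) ξ = -‖ξ‖ ^ 2 := by
      rw [ContinuousLinearMap.neg_apply, ContinuousLinearMap.neg_apply, innerSL_apply_apply,
        real_inner_self_eq_norm_sq]
    rw [hin, norm_smul, norm_smul]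
    simp [abs_of_pos Real.pi_pos]
    ring
  rw [h4] at h3
  rw [← div_eq_mul_inv, le_div_iff₀ hn]
  have h5 : 1 ≤ 2 * Real.pi := by linarith [Real.pi_gt_three]
  have h6 : 0 ≤ ‖𝓕 φ ξ‖ * ‖ξ‖ := by positivity
  have h7 : (2 * Real.pi * (‖𝓕 φ ξ‖ * ‖ξ‖)) * ‖ξ‖ ≤ (∫ x, ‖fderiv ℝ φ x‖) * ‖ξ‖ := by linarith
  have h8 := le_of_mul_le_mul_right h7 hn
  nlinarith

theorem reg_bound {φ : E → ℂ} (hc : ContDiff ℝ 1 φ) {C : ℝ} (hC : 0 ≤ C)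
    (hb : ∀ x, ‖fderiv ℝ φ x‖ ≤ C * (1 + ‖x‖) ^ (-((Module.finrank ℝ E : ℝ) + 3/2))) (x y : E)
    (hx : x ≠ 0) (hy : 2 * ‖y‖ ≤ ‖x‖) :
    ‖φ (x - y) - φ x‖ ≤ (C * 2 ^ ((Module.finrank ℝ E : ℝ) + 3/2)) * ‖y‖ *
      (‖x‖ ^ (Module.finrank ℝ E + 1))⁻¹ * wt (Real.log ‖x‖) := by
  set d := Module.finrank ℝ E
  have hn : 0 < ‖x‖ := norm_pos_iff.2 hx
  set r := (d:ℝ) + 3/2 with hr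
  have hr0 : 0 < r := by positivity
  have h1 : ‖φ (x - y) - φ x‖ ≤ (C * ((1 + ‖x‖) / 2) ^ (-r)) * ‖(x - y) - x‖ := by
    refine Convex.norm_image_sub_le_of_norm_fderiv_le (𝕜 := ℝ) (s := closedBall x ‖y‖)
      (fun z _ => (hc.differentiable (by norm_num)) z) (fun z hz => ?_)
      (convex_closedBall _ _) (mem_closedBall_self (norm_nonneg _)) (by simp [mem_closedBall, dist_eq_norm])
    refine (hb z).trans ?_
    have hz' : ‖z - x‖ ≤ ‖y‖ := by simpa [mem_closedBall, dist_eq_norm] using hz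
    have : ‖x‖ ≤ ‖z‖ + ‖z - x‖ := by
      have := norm_sub_le z (z - x); simpa using this
    gcongr C * ?_
    refine Real.rpow_le_rpow_of_nonpos (by positivity) (by linarith) (by linarith)
  have h2 : ‖(x - y) - x‖ = ‖y‖ := by simp
  rw [h2] at h1
  have h3 : ((1 + ‖x‖) / 2) ^ (-r) = 2 ^ r * (1 + ‖x‖) ^ (-r) := by
    rw [Real.div_rpow (by positivity) (by positivity), Real.rpow_neg (x := 2) (by norm_num)]
    field_simp
  have h4 : (1 + ‖x‖) ^ (-r) ≤ (‖x‖ ^ (d + 1))⁻¹ * wt (Real.log ‖x‖) := by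
    rw [← Real.rpow_natCast, ← Real.rpow_neg hn.le]
    rcases le_total ‖x‖ 1 with h | h
    · rw [wt_log_le_one hn h, ← Real.rpow_add hn]
      calc (1 + ‖x‖) ^ (-r) ≤ 1 := Real.rpow_le_one_of_one_le_of_nonpos (by linarith) (by linarith)
        _ ≤ _ := Real.one_le_rpow_of_pos_of_le_one_of_nonpos hn h (by push_cast; linarith [(Nat.cast_nonneg d : (0:ℝ) ≤ d)])
    · rw [wt_log_one_le h, ← Real.rpow_add hn]
      calc (1 + ‖x‖) ^ (-r) ≤ ‖x‖ ^ (-r) := Real.rpow_le_rpow_of_nonpos hn (by linarith) (by linarith)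
        _ ≤ _ := Real.rpow_le_rpow_of_exponent_le h (by push_cast; rw [hr]; linarith)
  calc _ ≤ _ := h1
    _ = C * 2 ^ r * ‖y‖ * (1 + ‖x‖) ^ (-r) := by rw [h3]; ring
    _ ≤ C * 2 ^ r * ‖y‖ * ((‖x‖ ^ (d + 1))⁻¹ * wt (Real.log ‖x‖)) := by gcongr
    _ = _ := by ring

theorem exists_LPk {φ : E → ℂ} (hc : ContDiff ℝ 1 φ) {C0 C1 : ℝ}
    (hb : ∀ x, ‖φ x‖ ≤ C0 * (1 + ‖x‖) ^ (-((Module.finrank ℝ E : ℝ) + 1/2)))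
    (hb' : ∀ x, ‖fderiv ℝ φ x‖ ≤ C1 * (1 + ‖x‖) ^ (-((Module.finrank ℝ E : ℝ) + 3/2)))
    (hm : ∫ x, φ x = 0) : ∃ C, LPk φ C := by
  set d := Module.finrank ℝ E
  have hi : Integrable φ := integrable_of_decay hc.continuous (by linarith) hb
  have hi' : Integrable (fderiv ℝ φ) := integrable_of_decay (hc.continuous_fderiv (by norm_num)) (by linarith) hb'
  obtain ⟨C2, h2⟩ := four_small hc.continuous hb hm
  have h3 := four_large hc hi hi'
  have hC1 : 0 ≤ C1 := by
    have := (norm_nonneg _).trans (hb' 0)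
    simpa using this
  have hC0 : 0 ≤ C0 := by
    have := (norm_nonneg _).trans (hb 0)
    simpa using this
  have h4 := reg_bound hc hC1 hb'
  set C3 := ∫ x, ‖fderiv ℝ φ x‖
  have hC3 : 0 ≤ C3 := integral_nonneg fun x => norm_nonneg _
  set C4 := C1 * 2 ^ ((d : ℝ) + 3/2)
  have hC4 : 0 ≤ C4 := by positivity
  refine ⟨C0 + |C2| + C3 + C4, hc.continuous, hi, ?_, ?_, ?_, ?_⟩
  · intro x
    refine (hb x).trans ?_
    have : (1 + ‖x‖) ^ (-((d : ℝ) + 1/2)) ≤ 1 :=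
      Real.rpow_le_one_of_one_le_of_nonpos (by linarith [norm_nonneg x]) (by linarith [(Nat.cast_nonneg d : (0:ℝ) ≤ d)])
    nlinarith [abs_nonneg C2]
  · rw [Real.fourier_eq]; simpa using hm
  · intro ξ hξ
    have hn : 0 < ‖ξ‖ := norm_pos_iff.2 hξ
    rcases le_total ‖ξ‖ 1 with h | h
    · rw [wt_log_le_one hn h]
      refine (h2 ξ).trans ?_
      gcongr
      linarith [le_abs_self C2]
    · rw [wt_log_one_le h]
      refine (h3 ξ hξ).trans ?_
      rw [← Real.rpow_neg_one]
      have : ‖ξ‖ ^ (-1:ℝ) ≤ ‖ξ‖ ^ (-(1/4) : ℝ) := Real.rpow_le_rpow_of_exponent_le h (by norm_num)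
      have h0 : 0 ≤ ‖ξ‖ ^ (-1:ℝ) := by positivity
      refine mul_le_mul ?_ this h0 (by positivity)
      linarith [abs_nonneg C2]
  · intro x y hx hy
    refine (h4 x y hx hy).trans ?_
    have := wt_pos (Real.log ‖x‖)
    gcongr
    linarith [abs_nonneg C2]

theorem LPk.reflect {φ : E → ℂ} {C : ℝ} (h : LPk φ C) : LPk (fun x => φ (-x)) C where
  cont := h.cont.comp continuous_neg
  int := h.int.comp_neg
  bdd x := h.bdd _
  four0 := by
    have := h.four0
    rw [Real.fourier_eq] at this ⊢
    simp only [inner_zero_right, neg_zero, AddChar.map_zero_eq_one, one_smul] at this ⊢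
    rw [integral_neg_eq_self (fun x => φ x), this]
  four ξ hξ := by
    have h1 : 𝓕 (fun x => φ (-x)) ξ = 𝓕 φ (-ξ) := by
      rw [Real.fourier_eq, Real.fourier_eq, ← integral_neg_eq_self]
      simp
    rw [h1, ← norm_neg ξ]
    exact h.four (-ξ) (by simpa using hξ)
  reg x y hx hy := by
    have := h.reg (-x) (-y) (by simpa using hx) (by simpa using hy)
    simp only [norm_neg] at this
    rwa [show -x - -y = -(x - y) by abel] at this

end LPproof
end

section
open MeasureTheory Set Metric Filter
open scoped ENNReal NNReal Topology FourierTransform ContDiff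

namespace LPproof
variable {E : Type*} [NormedAddCommGroup E] [InnerProductSpace ℝ E] [FiniteDimensional ℝ E]
  [MeasurableSpace E] [BorelSpace E]

/-- dilates of `φ` -/
noncomputable def dil (φ : E → ℂ) (t : ℝ) (x : E) : ℂ := (t ^ Module.finrank ℝ E : ℝ)⁻¹ • φ (t⁻¹ • x)

theorem fourier_dil (φ : E → ℂ) {t : ℝ} (ht : 0 < t) (ξ : E) : 𝓕 (dil φ t) ξ = 𝓕 φ (t • ξ) := by
  rw [Real.fourier_eq, Real.fourier_eq]
  unfold dil
  have h := Measure.integral_comp_inv_smul_of_nonneg (volume : Measure E)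
    (fun u : E => Real.fourierChar (-(inner ℝ u (t • ξ))) • φ u) ht.le
  have h2 : ∀ x : E, inner ℝ (t⁻¹ • x) (t • ξ) = inner ℝ x ξ := by
    intro x
    rw [inner_smul_left, inner_smul_right]
    simp
    field_simp
  simp_rw [h2] at h
  have h3 : ∀ x : E, Real.fourierChar (-(inner ℝ x ξ)) • (t ^ Module.finrank ℝ E : ℝ)⁻¹ • φ (t⁻¹ • x)
      = (t ^ Module.finrank ℝ E : ℝ)⁻¹ • Real.fourierChar (-(inner ℝ x ξ)) • φ (t⁻¹ • x) := fun x => smul_comm _ _ _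
  simp_rw [h3]
  rw [integral_smul, h, smul_smul, inv_mul_cancel₀ (by positivity), one_smul]

theorem integrable_dil {φ : E → ℂ} (h : Integrable φ) {t : ℝ} (ht : 0 < t) : Integrable (dil φ t) := by
  unfold dil
  exact (h.comp_smul (inv_ne_zero ht.ne')).smul ((t ^ Module.finrank ℝ E : ℝ)⁻¹)

theorem continuous_dil {φ : E → ℂ} (h : Continuous φ) (t : ℝ) : Continuous (dil φ t) := by
  unfold dil; fun_prop

theorem continuous_dil_exp {φ : E → ℂ} (h : Continuous φ) :
    Continuous fun q : ℝ × E => dil φ (Real.exp q.1) q.2 := by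
  unfold dil
  have h1 : ∀ q : ℝ × E, (Real.exp q.1)⁻¹ = Real.exp (-q.1) := fun q => (Real.exp_neg _).symm
  have h2 : ∀ q : ℝ × E, (Real.exp q.1 ^ Module.finrank ℝ E)⁻¹ = Real.exp (-q.1) ^ Module.finrank ℝ E := fun q => by
    rw [Real.exp_neg, inv_pow]
  simp_rw [h1, h2]
  fun_prop

theorem dil_bdd {φ : E → ℂ} {C : ℝ} (h : LPk φ C) (t : ℝ) : ∃ B, ∀ x, ‖dil φ t x‖ ≤ B := by
  refine ⟨‖(t ^ Module.finrank ℝ E : ℝ)⁻¹‖ * C, fun x => ?_⟩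
  unfold dil
  rw [norm_smul]
  gcongr
  exact h.bdd _

theorem dil_four {φ : E → ℂ} {C : ℝ} (h : LPk φ C) (s : ℝ) {ξ : E} (hξ : ξ ≠ 0) :
    ‖𝓕 (dil φ (Real.exp s)) ξ‖ ≤ C * wt (s + Real.log ‖ξ‖) := by
  rw [fourier_dil _ (Real.exp_pos s)]
  have h1 := h.four (Real.exp s • ξ) (smul_ne_zero (Real.exp_pos s).ne' hξ)
  rwa [norm_smul, Real.norm_of_nonneg (Real.exp_pos s).le,
    Real.log_mul (Real.exp_pos s).ne' (norm_ne_zero_iff.2 hξ), Real.log_exp] at h1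

theorem dil_four0 {φ : E → ℂ} {C : ℝ} (h : LPk φ C) (s : ℝ) :
    𝓕 (dil φ (Real.exp s)) (0 : E) = 0 := by
  rw [fourier_dil _ (Real.exp_pos s), smul_zero, h.four0]

theorem dil_reg {φ : E → ℂ} {C : ℝ} (h : LPk φ C) (s : ℝ) {x y : E} (hx : x ≠ 0) (hy : 2 * ‖y‖ ≤ ‖x‖) :
    ‖dil φ (Real.exp s) (x - y) - dil φ (Real.exp s) x‖ ≤
      C * ‖y‖ * (‖x‖ ^ (Module.finrank ℝ E + 1))⁻¹ * wt (Real.log ‖x‖ - s) := by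
  set t := Real.exp s with ht
  have htp : 0 < t := Real.exp_pos s
  have hn : 0 < ‖x‖ := norm_pos_iff.2 hx
  have hti : ‖t⁻¹‖ = t⁻¹ := Real.norm_of_nonneg (by positivity)
  have h1 := h.reg (t⁻¹ • x) (t⁻¹ • y) (smul_ne_zero (by positivity) hx) (by
    rw [norm_smul, norm_smul, hti]
    have : 0 ≤ t⁻¹ := by positivity
    nlinarith)
  rw [← smul_sub] at h1
  unfold dil
  rw [← smul_sub, norm_smul, Real.norm_of_nonneg (by positivity)]
  rw [norm_smul, norm_smul, hti, Real.log_mul (by positivity) hn.ne', Real.log_inv, ht, Real.log_exp,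
    ← ht, show -s + Real.log ‖x‖ = Real.log ‖x‖ - s by ring] at h1
  set d := Module.finrank ℝ E
  calc _ ≤ (t ^ d)⁻¹ * (C * (t⁻¹ * ‖y‖) * ((t⁻¹ * ‖x‖) ^ (d + 1))⁻¹ * wt (Real.log ‖x‖ - s)) := by gcongr
    _ = _ := by
      rw [mul_pow, mul_inv, inv_pow, inv_inv]
      field_simp
      ring

theorem wt_int : ∫⁻ s : ℝ, ENNReal.ofReal (wt s) ^ 2 ≠ ⊤ := by
  have h : Integrable fun s : ℝ => Real.exp (-(1/2) * |s|) := by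
    have hp : IntegrableOn (fun s : ℝ => Real.exp (-(1/2) * |s|)) (Ioi 0) := by
      refine (integrableOn_exp_mul_Ioi (a := -(1/2)) (by norm_num) 0).congr_fun (fun s hs => ?_) measurableSet_Ioi
      simp only
      rw [abs_of_pos hs]
    have hm : IntegrableOn (fun s : ℝ => Real.exp (-(1/2) * |s|)) (Iic 0) := by
      refine (integrableOn_exp_mul_Iic (a := (1/2)) (by norm_num) 0).congr_fun (fun s hs => ?_) measurableSet_Iic
      simp only
      rw [abs_of_nonpos hs]; ring_nf
    rw [← integrableOn_univ, ← Iic_union_Ioi (a := (0:ℝ))]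
    exact hm.union hp
  have h1 : ∀ s : ℝ, ENNReal.ofReal (wt s) ^ 2 = ENNReal.ofReal (Real.exp (-(1/2) * |s|)) := by
    intro s
    rw [← ENNReal.ofReal_pow (wt_pos s).le, wt, ← Real.exp_nat_mul]
    congr 2
    push_cast; ring
  simp_rw [h1]
  exact h.lintegral_lt_top.ne

theorem wt_sum : ∃ J : ℝ, 0 ≤ J ∧ ∀ (s : Finset ℤ) (a : ℝ), ∑ k ∈ s, wt (k + a) ≤ J := by
  have hs : Summable fun k : ℤ => wt k := by
    have hn : Summable fun k : ℕ => wt k := by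
      have : Summable fun k : ℕ => Real.exp (-(1/4)) ^ k :=
        summable_geometric_of_lt_one (Real.exp_pos _).le (by rw [Real.exp_lt_one_iff]; norm_num)
      refine this.congr fun k => ?_
      rw [wt, ← Real.exp_nat_mul]
      congr 1
      rw [abs_of_nonneg (by positivity)]; ring
    refine Summable.of_nat_of_neg (by simpa using hn) ?_
    simpa [wt_neg] using hn
  refine ⟨Real.exp (1/4) * ∑' k : ℤ, wt k, mul_nonneg (Real.exp_pos _).le (tsum_nonneg fun k => (wt_pos _).le), ?_⟩
  intro s a
  calc ∑ k ∈ s, wt (k + a) ≤ ∑ k ∈ s, Real.exp (1/4) * wt ((k + ⌊a⌋ : ℤ) : ℝ) := by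
        refine Finset.sum_le_sum fun k _ => ?_
        unfold wt
        rw [← Real.exp_add]
        refine Real.exp_le_exp.2 ?_
        have h1 := Int.floor_le a
        have h2 := Int.lt_floor_add_one a
        have h3 : |((k + ⌊a⌋ : ℤ) : ℝ)| ≤ |(k:ℝ) + a| + 1 := by
          have : ((k + ⌊a⌋ : ℤ) : ℝ) = ((k:ℝ) + a) + (⌊a⌋ - a) := by push_cast; ring
          rw [this]
          refine (abs_add_le _ _).trans ?_
          gcongr
          rw [abs_le]; constructor <;> linarith
        linarith
    _ = Real.exp (1/4) * ∑ k ∈ s.map (addRightEmbedding ⌊a⌋), wt (k : ℝ) := by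
        rw [← Finset.mul_sum, Finset.sum_map]
        simp
    _ ≤ _ := by
        gcongr
        exact hs.sum_le_tsum _ fun k _ => (wt_pos _).le

end LPproof
end

section
open MeasureTheory Set Metric Filter
open scoped ENNReal NNReal Topology FourierTransform ContDiff

namespace LPproof
variable {E : Type*} [NormedAddCommGroup E] [InnerProductSpace ℝ E] [FiniteDimensional ℝ E]
  [MeasurableSpace E] [BorelSpace E]

theorem czk_dil {φ : E → ℂ} {C : ℝ} (h : LPk φ C) :
    ∃ A : ℝ≥0∞, A ≠ ⊤ ∧ CZK volume (fun s : ℝ => dil φ (Real.exp s)) A := by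
  have hC := h.nonneg
  set J := ∫⁻ s : ℝ, ENNReal.ofReal (wt s) ^ 2 with hJ
  have hJt : J ≠ ⊤ := wt_int
  have hwm : Measurable wt := continuous_wt.measurable
  set c := ENNReal.ofReal C with hc
  have hct : c ≠ ⊤ := ENNReal.ofReal_ne_top
  have hsh1 : ∀ a : ℝ, ∫⁻ s : ℝ, ENNReal.ofReal (wt (s + a)) ^ 2 = J := fun a =>
    lintegral_add_right_eq_self (fun s : ℝ => ENNReal.ofReal (wt s) ^ 2) a
  have hsh2 : ∀ a : ℝ, ∫⁻ s : ℝ, ENNReal.ofReal (wt (a - s)) ^ 2 = J := fun a => by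
    rw [← hsh1 (-a)]
    refine lintegral_congr fun s => ?_
    rw [← wt_neg]; congr 3; ring
  refine ⟨c ^ 2 * J + c * (J + 1), by finiteness, ?_, ?_, ?_, ?_, ?_⟩
  · exact (continuous_dil_exp h.cont).measurable
  · exact fun s => integrable_dil h.int (Real.exp_pos s)
  · exact fun s => dil_bdd h _
  · intro ξ
    refine le_trans ?_ le_self_add
    by_cases hξ : ξ = 0
    · subst hξ; simp [dil_four0 h]
    · calc _ ≤ ∫⁻ s : ℝ, c ^ 2 * ENNReal.ofReal (wt (s + Real.log ‖ξ‖)) ^ 2 := by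
            refine lintegral_mono fun s => ?_
            rw [← mul_pow]
            refine pow_le_pow_left₀ zero_le ?_ 2
            rw [← ofReal_norm, hc, ← ENNReal.ofReal_mul hC]
            exact ENNReal.ofReal_le_ofReal (dil_four h s hξ)
        _ = c ^ 2 * J := by
            rw [lintegral_const_mul _ (by fun_prop), hsh1]
  · refine ⟨fun s x => ENNReal.ofReal (C * (‖x‖ ^ (Module.finrank ℝ E + 1))⁻¹ * wt (Real.log ‖x‖ - s)), ?_, ?_, ?_⟩
    · fun_prop
    · intro s x y hy
      by_cases hx : x = 0
      · subst hx
        have : y = 0 := by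
          rw [norm_zero] at hy
          exact norm_le_zero_iff.1 (by linarith)
        subst this; simp
      · rw [← ofReal_norm, ← ENNReal.ofReal_mul (norm_nonneg _)]
        refine ENNReal.ofReal_le_ofReal ((dil_reg h s hx hy).trans (le_of_eq ?_))
        ring
    · intro x hx
      set M := (‖x‖ ^ (Module.finrank ℝ E + 1))⁻¹ with hM
      have hM0 : 0 ≤ M := by positivity
      calc _ = ∫⁻ s : ℝ, (c * ENNReal.ofReal M) ^ 2 * ENNReal.ofReal (wt (Real.log ‖x‖ - s)) ^ 2 := by
            refine lintegral_congr fun s => ?_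
            beta_reduce
            rw [ENNReal.ofReal_mul (by positivity), ENNReal.ofReal_mul hC, mul_pow]
        _ = (c * ENNReal.ofReal M) ^ 2 * J := by
            rw [lintegral_const_mul _ (by fun_prop), hsh2]
        _ ≤ (c * ENNReal.ofReal M) ^ 2 * (J + 1) ^ 2 := by
            gcongr
            calc J ≤ J + 1 := le_self_add
              _ = (J + 1) * 1 := (mul_one _).symm
              _ ≤ (J + 1) * (J + 1) := by gcongr; exact le_add_self
              _ = _ := (sq _).symm
        _ = (c * (J + 1) * ENNReal.ofReal M) ^ 2 := by ring
        _ ≤ _ := by gcongr; exact le_add_self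

/-- signed sums of dilates -/
noncomputable def sgn (φ : E → ℂ) (τ : ℝ) (F : Finset ℤ) (ε : ℤ → ℂ) (x : E) : ℂ :=
  ∑ k ∈ F, ε k * dil φ (Real.exp (k + τ)) x

theorem continuous_sgn {φ : E → ℂ} {C : ℝ} (h : LPk φ C) (τ : ℝ) (F : Finset ℤ) (ε : ℤ → ℂ) :
    Continuous (sgn φ τ F ε) := by
  unfold sgn
  refine continuous_finsetSum _ fun k _ => continuous_const.mul (continuous_dil h.cont _)

theorem integrable_sgn {φ : E → ℂ} {C : ℝ} (h : LPk φ C) (τ : ℝ) (F : Finset ℤ) (ε : ℤ → ℂ) :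
    Integrable (sgn φ τ F ε) := by
  unfold sgn
  exact integrable_finsetSum _ fun k _ => (integrable_dil h.int (Real.exp_pos _)).const_mul _

theorem sgn_bdd {φ : E → ℂ} {C : ℝ} (h : LPk φ C) (τ : ℝ) (F : Finset ℤ) (ε : ℤ → ℂ) :
    ∃ B : ℝ, ∀ x, ‖sgn φ τ F ε x‖ ≤ B := by
  choose B hB using fun t => dil_bdd h t
  refine ⟨∑ k ∈ F, ‖ε k‖ * B (Real.exp (k + τ)), fun x => ?_⟩
  unfold sgn
  refine norm_sum_le_of_le _ fun k _ => ?_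
  rw [norm_mul]
  gcongr
  exact hB _ x

theorem fourier_sgn {φ : E → ℂ} {C : ℝ} (h : LPk φ C) (τ : ℝ) (F : Finset ℤ) (ε : ℤ → ℂ) (ξ : E) :
    𝓕 (sgn φ τ F ε) ξ = ∑ k ∈ F, ε k * 𝓕 (dil φ (Real.exp (k + τ))) ξ := by
  simp_rw [Real.fourier_eq]
  unfold sgn
  simp_rw [Finset.smul_sum]
  rw [integral_finsetSum]
  · refine Finset.sum_congr rfl fun k _ => ?_
    rw [← integral_const_mul]
    refine integral_congr_ae (Eventually.of_forall fun v => ?_)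
    simp only [Circle.smul_def, smul_eq_mul]
    ring
  · intro k _
    have := (Real.fourierIntegral_convergent_iff (μ := volume) (f := fun x => ε k * dil φ (Real.exp (k + τ)) x) ξ).2
      ((integrable_dil h.int (Real.exp_pos _)).const_mul _)
    exact this

theorem czk_sgn {φ : E → ℂ} {C : ℝ} (h : LPk φ C) :
    ∃ A : ℝ≥0∞, A ≠ ⊤ ∧ ∀ (τ : ℝ) (F : Finset ℤ) (ε : ℤ → ℂ), (∀ k, ‖ε k‖ ≤ 1) →
      CZK (Measure.dirac ()) (fun _ : Unit => sgn φ τ F ε) A := by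
  have hC := h.nonneg
  obtain ⟨J, hJ0, hJ⟩ := wt_sum
  refine ⟨ENNReal.ofReal (C * J) ^ 2 + ENNReal.ofReal (C * J), by finiteness, ?_⟩
  intro τ F ε hε
  refine ⟨?_, ?_, ?_, ?_, ?_⟩
  · exact (continuous_sgn h τ F ε).measurable.comp measurable_snd
  · exact fun _ => integrable_sgn h τ F ε
  · exact fun _ => sgn_bdd h τ F ε
  · intro ξ
    refine le_trans ?_ le_self_add
    rw [lintegral_dirac]
    refine pow_le_pow_left₀ zero_le ?_ 2
    rw [← ofReal_norm]
    refine ENNReal.ofReal_le_ofReal ?_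
    rw [fourier_sgn h]
    by_cases hξ : ξ = 0
    · subst hξ; simp [dil_four0 h]; positivity
    calc _ ≤ ∑ k ∈ F, C * wt (k + (τ + Real.log ‖ξ‖)) := by
          refine norm_sum_le_of_le _ fun k _ => ?_
          rw [norm_mul, ← add_assoc]
          exact (mul_le_of_le_one_left (norm_nonneg _) (hε k)).trans (dil_four h _ hξ)
      _ ≤ C * J := by
          rw [← Finset.mul_sum]
          gcongr
          exact hJ _ _
  · refine ⟨fun _ x => ENNReal.ofReal (C * J * (‖x‖ ^ (Module.finrank ℝ E + 1))⁻¹), ?_, ?_, ?_⟩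
    · fun_prop
    · intro _ x y hy
      by_cases hx : x = 0
      · subst hx
        have : y = 0 := by
          rw [norm_zero] at hy
          exact norm_le_zero_iff.1 (by linarith)
        subst this; simp
      · rw [← ofReal_norm, ← ENNReal.ofReal_mul (norm_nonneg _)]
        refine ENNReal.ofReal_le_ofReal ?_
        unfold sgn
        rw [← Finset.sum_sub_distrib]
        calc _ ≤ ∑ k ∈ F, C * ‖y‖ * (‖x‖ ^ (Module.finrank ℝ E + 1))⁻¹ * wt (k + (τ - Real.log ‖x‖)) := by
              refine norm_sum_le_of_le _ fun k _ => ?_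
              rw [← mul_sub, norm_mul]
              refine (mul_le_of_le_one_left (norm_nonneg _) (hε k)).trans ((dil_reg h _ hx hy).trans (le_of_eq ?_))
              rw [← wt_neg]; congr 2; ring
          _ ≤ C * ‖y‖ * (‖x‖ ^ (Module.finrank ℝ E + 1))⁻¹ * J := by
              rw [← Finset.mul_sum]
              gcongr
              exact hJ _ _
          _ = _ := by ring
    · intro x hx
      rw [lintegral_dirac]
      beta_reduce
      rw [ENNReal.ofReal_mul (p := C * J) (by positivity)]
      exact pow_le_pow_left₀ zero_le (mul_le_mul_left le_add_self _) 2

end LPproof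
end

section
open MeasureTheory Set Metric Filter
open scoped ENNReal NNReal Topology FourierTransform ContDiff

namespace LPproof
variable {E : Type*} [NormedAddCommGroup E] [InnerProductSpace ℝ E] [FiniteDimensional ℝ E]
  [MeasurableSpace E] [BorelSpace E]

theorem continuous_cv {f K : E → ℂ} {B : ℝ} (hf : Integrable f) (hKc : Continuous K)
    (hK : ∀ x, ‖K x‖ ≤ B) : Continuous (cv f K) := by
  rw [cv_eq]
  refine BddAbove.continuous_convolution_right_of_integrable _ ⟨B, ?_⟩ hf hKc
  rintro _ ⟨x, rfl⟩
  exact hK x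

theorem cv_adjoint {f K h : E → ℂ} {B : ℝ} (hf : Integrable f) (hK : Integrable K)
    (hh : Continuous h) (hhB : ∀ x, ‖h x‖ ≤ B) :
    ∫ x, cv f K x * h x = ∫ y, f y * cv h (fun z => K (-z)) y := by
  unfold cv
  have h1 : Integrable (fun q : E × E => (f q.2 * K (q.1 - q.2)) * h q.1) (volume.prod volume) := by
    refine Integrable.mul_bdd (c := B) ?_ ?_ (Eventually.of_forall fun q => hhB _)
    · exact Integrable.convolution_integrand (ContinuousLinearMap.mul ℂ ℂ) hf hK
    · exact (hh.comp continuous_fst).aestronglyMeasurable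
  simp_rw [← integral_mul_const, ← integral_const_mul]
  rw [integral_integral_swap (f := fun x y => (f y * K (x - y)) * h x) h1]
  refine integral_congr_ae (Eventually.of_forall fun y => ?_)
  refine integral_congr_ae (Eventually.of_forall fun x => ?_)
  simp only [neg_sub]
  ring

theorem duality {f K : E → ℂ} {p q : ℝ} (hpq : p.HolderConjugate q) (hp2 : 2 < p)
    (hfc : Continuous f) (hf : Integrable f) {Bf BK : ℝ} (hfB : ∀ x, ‖f x‖ ≤ Bf)
    (hKc : Continuous K) (hK : Integrable K) (hKB : ∀ x, ‖K x‖ ≤ BK) {C : ℝ≥0∞}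
    (H : ∀ h : E → ℂ, Continuous h → Integrable h → (∃ B : ℝ, ∀ x, ‖h x‖ ≤ B) →
      ∫⁻ x, ‖cv h (fun z => K (-z)) x‖ₑ ^ q ≤ C * ∫⁻ x, ‖h x‖ₑ ^ q) :
    ∫⁻ x, ‖cv f K x‖ₑ ^ p ≤ C ^ (p / q) * ∫⁻ x, ‖f x‖ₑ ^ p := by
  set v := cv f K with hv
  have hp0 : 0 < p := by linarith
  have hq0 : 0 < q := hpq.symm.pos
  have hvc : Continuous v := continuous_cv hf hKc hKB
  have hvi : Integrable v := integrable_cv hf hK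
  obtain ⟨B, hvB⟩ : ∃ B : ℝ, ∀ x, ‖v x‖ ≤ B := ⟨_, cv_bdd hfB hK⟩
  have hB0 : 0 ≤ B := (norm_nonneg _).trans (hvB 0)
  have hVt : ∫⁻ x, ‖v x‖ₑ ^ p ≠ ⊤ := lintegral_rpow_ne_top hvi hvB (by linarith)
  set w : E → ℝ := fun x => ‖v x‖ ^ (p - 2) with hw
  have hwc : Continuous w := hvc.norm.rpow_const fun x => Or.inr (by linarith)
  have hw0 : ∀ x, 0 ≤ w x := fun x => by positivity
  have hwB : ∀ x, w x ≤ B ^ (p - 2) := fun x =>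
    Real.rpow_le_rpow (norm_nonneg _) (hvB x) (by linarith)
  set h : E → ℂ := fun x => (starRingEnd ℂ) (v x) * (w x : ℂ) with hh
  have hhc : Continuous h := by
    refine (Complex.continuous_conj.comp hvc).mul (Complex.continuous_ofReal.comp hwc)
  have hhn : ∀ x, ‖h x‖ = ‖v x‖ * w x := fun x => by
    rw [hh]; simp [abs_of_nonneg (hw0 x)]
  have hhB : ∀ x, ‖h x‖ ≤ B * B ^ (p - 2) := fun x => by
    rw [hhn]
    exact mul_le_mul (hvB x) (hwB x) (hw0 x) hB0
  have hhi : Integrable h := by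
    refine Integrable.mono' (hvi.norm.mul_const (B ^ (p - 2))) hhc.aestronglyMeasurable
      (Eventually.of_forall fun x => ?_)
    rw [hhn]
    gcongr
    exact hwB x
  have hhn' : ∀ x, ‖h x‖ = ‖v x‖ ^ (p - 1) := fun x => by
    rw [hhn, hw]
    rcases (norm_nonneg (v x)).eq_or_lt with h0 | h0
    · rw [← h0, Real.zero_rpow (by linarith)]; simp
    · simp only
      rw [show p - 1 = 1 + (p - 2) by ring, Real.rpow_add h0, Real.rpow_one]
  have hhq : ∀ x, ‖h x‖ₑ ^ q = ‖v x‖ₑ ^ p := fun x => by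
    rw [← ofReal_norm, hhn', ← ENNReal.ofReal_rpow_of_nonneg (norm_nonneg _) (by linarith),
      ofReal_norm, ← ENNReal.rpow_mul, hpq.sub_one_mul_conj]
  have hvh : ∀ x, v x * h x = ((‖v x‖ ^ p : ℝ) : ℂ) := fun x => by
    rw [hh]
    simp only
    rw [← mul_assoc, Complex.mul_conj, ← Complex.ofReal_mul, Complex.normSq_eq_norm_sq]
    congr 1
    rw [hw]
    simp only
    rcases (norm_nonneg (v x)).eq_or_lt with h0 | h0
    · rw [← h0, Real.zero_rpow hp0.ne']; simp
    · rw [← Real.rpow_natCast, ← Real.rpow_add h0]; congr 1; push_cast; ring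
  have hV1 : ∫⁻ x, ‖v x‖ₑ ^ p = ‖∫ x, v x * h x‖ₑ := by
    simp_rw [hvh]
    have e : ∀ x, ‖v x‖ₑ ^ p = ENNReal.ofReal (‖v x‖ ^ p) := fun x => by
      rw [← ENNReal.ofReal_rpow_of_nonneg (norm_nonneg _) hp0.le, ofReal_norm]
    have hvint : Integrable fun x => ‖v x‖ ^ p := by
      refine ⟨(hvc.norm.rpow_const fun x => Or.inr hp0.le).aestronglyMeasurable, ?_⟩
      rw [hasFiniteIntegral_iff_ofReal (Eventually.of_forall fun x => by positivity)]
      simp_rw [← e]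
      exact hVt.lt_top
    rw [integral_complex_ofReal, ← ofReal_norm, Complex.norm_real,
      Real.norm_of_nonneg (integral_nonneg fun x => by positivity),
      ofReal_integral_eq_lintegral_ofReal hvint (Eventually.of_forall fun x => by positivity)]
    exact lintegral_congr e
  have hgi : Continuous (cv h (fun z => K (-z))) :=
    continuous_cv hhi (hKc.comp continuous_neg) fun x => hKB (-x)
  set V := ∫⁻ x, ‖v x‖ₑ ^ p with hVdef
  set F := ∫⁻ x, ‖f x‖ₑ ^ p with hF
  have hmain : V ≤ F ^ (1 / p) * (C * V) ^ (1 / q) := by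
    calc V = ‖∫ y, f y * cv h (fun z => K (-z)) y‖ₑ := by
          rw [hV1, cv_adjoint hf hK hhc hhB]
      _ ≤ ∫⁻ y, ‖f y * cv h (fun z => K (-z)) y‖ₑ := enorm_integral_le_lintegral_enorm _
      _ = ∫⁻ y, ((fun y => ‖f y‖ₑ) * fun y => ‖cv h (fun z => K (-z)) y‖ₑ) y := by
          simp [enorm_mul]
      _ ≤ F ^ (1 / p) * (∫⁻ y, ‖cv h (fun z => K (-z)) y‖ₑ ^ q) ^ (1 / q) :=
          ENNReal.lintegral_mul_le_Lp_mul_Lq _ hpq hfc.measurable.enorm.aemeasurable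
            hgi.measurable.enorm.aemeasurable
      _ ≤ F ^ (1 / p) * (C * V) ^ (1 / q) := by
          gcongr
          refine (H h hhc hhi ⟨_, hhB⟩).trans ?_
          simp_rw [hhq]
          exact le_rfl
  by_cases hV0 : V = 0
  · rw [hV0]; exact zero_le
  rw [ENNReal.mul_rpow_of_nonneg _ _ (by positivity), ← mul_assoc] at hmain
  have hVp : V ^ (1 / q) ≠ 0 := by
    simp [hV0, hVt]
  have hVp' : V ^ (1 / q) ≠ ⊤ := ENNReal.rpow_ne_top_of_nonneg (by positivity) hVt
  have hsplit : V = V ^ (1 / p) * V ^ (1 / q) := by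
    rw [← ENNReal.rpow_add _ _ hV0 hVt]
    have := hpq.inv_add_inv_eq_one
    rw [one_div, one_div, this, ENNReal.rpow_one]
  have h2 : V ^ (1 / p) ≤ F ^ (1 / p) * C ^ (1 / q) := by
    rw [hsplit] at hmain
    rw [← hsplit] at hmain
    have h3 : V ^ (1 / p) * V ^ (1 / q) ≤ F ^ (1 / p) * C ^ (1 / q) * V ^ (1 / q) := hsplit ▸ hmain
    exact (ENNReal.mul_le_mul_iff_left hVp hVp').1 h3
  have h3 := ENNReal.rpow_le_rpow h2 hp0.le
  rw [ENNReal.mul_rpow_of_nonneg _ _ hp0.le, ← ENNReal.rpow_mul, ← ENNReal.rpow_mul, ← ENNReal.rpow_mul,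
    one_div_mul_cancel hp0.ne', ENNReal.rpow_one, ENNReal.rpow_one, mul_comm F] at h3
  rwa [show 1 / q * p = p / q by ring] at h3

end LPproof
end

section
open MeasureTheory Set Metric Filter
open scoped ENNReal NNReal Topology FourierTransform ContDiff

namespace LPproof

theorem para_enorm (a b : ℂ) (S : ℝ≥0∞) {r : ℝ} (hr : 1 ≤ r) :
    (‖a‖ₑ ^ 2 + (‖b‖ₑ ^ 2 + S)) ^ r ≤
      2⁻¹ * (‖a + b‖ₑ ^ 2 + S) ^ r + 2⁻¹ * (‖a - b‖ₑ ^ 2 + S) ^ r := by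
  have h := parallelogram_law_with_norm ℂ a b
  have h' := congrArg ENNReal.ofReal h
  rw [ENNReal.ofReal_add (by positivity) (by positivity), ENNReal.ofReal_mul (by norm_num),
    ENNReal.ofReal_add (by positivity) (by positivity)] at h'
  simp only [ENNReal.ofReal_pow (norm_nonneg _), ofReal_norm, ENNReal.ofReal_ofNat] at h'
  have e : ‖a‖ₑ ^ 2 + (‖b‖ₑ ^ 2 + S) = 2⁻¹ * (‖a + b‖ₑ ^ 2 + S) + 2⁻¹ * (‖a - b‖ₑ ^ 2 + S) := by
    calc _ = 2⁻¹ * (2 * (‖a‖ₑ ^ 2 + ‖b‖ₑ ^ 2)) + (2⁻¹ + 2⁻¹) * S := by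
          rw [← mul_assoc, ENNReal.inv_mul_cancel (by norm_num) (by norm_num),
            ENNReal.inv_two_add_inv_two]
          ring
      _ = _ := by rw [← h']; ring
  rw [e]
  exact ENNReal.rpow_arith_mean_le_arith_mean2_rpow _ _ _ _ ENNReal.inv_two_add_inv_two hr

theorem signs {X : Type*} [MeasurableSpace X] {μ : Measure X} {r : ℝ} (hr : 1 ≤ r) {C : ℝ≥0∞}
    (a : ℤ → X → ℂ) (ha : ∀ k, Measurable (a k)) (F : Finset ℤ) :
    ∀ A : X → ℂ, Measurable A → (∀ ε : ℤ → ℂ, (∀ k, ε k = 1 ∨ ε k = -1) →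
      ∫⁻ x, (‖A x + ∑ k ∈ F, ε k * a k x‖ₑ ^ 2) ^ r ∂μ ≤ C) →
    ∫⁻ x, (‖A x‖ₑ ^ 2 + ∑ k ∈ F, ‖a k x‖ₑ ^ 2) ^ r ∂μ ≤ C := by
  induction F using Finset.induction_on with
  | empty =>
    intro A hA h
    simpa using h (fun _ => 1) (fun _ => Or.inl rfl)
  | insert j F hj ih =>
    intro A hA h
    have key : ∀ σ : ℂ, (σ = 1 ∨ σ = -1) →
        ∫⁻ x, (‖A x + σ * a j x‖ₑ ^ 2 + ∑ k ∈ F, ‖a k x‖ₑ ^ 2) ^ r ∂μ ≤ C := by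
      intro σ hσ
      refine ih (fun x => A x + σ * a j x) (hA.add ((ha j).const_mul σ)) fun ε hε => ?_
      have h1 := h (Function.update ε j σ) (fun k => by
        by_cases hk : k = j
        · subst hk; simpa using hσ
        · simpa [hk] using hε k)
      refine le_trans (le_of_eq ?_) h1
      refine lintegral_congr fun x => ?_
      rw [Finset.sum_insert hj, Function.update_self, ← add_assoc]
      congr 4
      refine Finset.sum_congr rfl fun k hk => ?_
      rw [Function.update_of_ne]
      rintro rfl; exact hj hk
    have k1 := key 1 (Or.inl rfl)
    have k2 := key (-1) (Or.inr rfl)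
    simp only [one_mul, neg_one_mul, ← sub_eq_add_neg] at k1 k2
    have m1 : Measurable fun x => (‖A x + a j x‖ₑ ^ 2 + ∑ k ∈ F, ‖a k x‖ₑ ^ 2) ^ r := by
      have := ha j
      fun_prop
    have m2 : Measurable fun x => (‖A x - a j x‖ₑ ^ 2 + ∑ k ∈ F, ‖a k x‖ₑ ^ 2) ^ r := by
      have := ha j
      fun_prop
    calc _ ≤ ∫⁻ x, (2⁻¹ * (‖A x + a j x‖ₑ ^ 2 + ∑ k ∈ F, ‖a k x‖ₑ ^ 2) ^ r +
            2⁻¹ * (‖A x - a j x‖ₑ ^ 2 + ∑ k ∈ F, ‖a k x‖ₑ ^ 2) ^ r) ∂μ := by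
          refine lintegral_mono fun x => ?_
          rw [Finset.sum_insert hj]
          exact para_enorm _ _ _ hr
      _ = 2⁻¹ * (∫⁻ x, (‖A x + a j x‖ₑ ^ 2 + ∑ k ∈ F, ‖a k x‖ₑ ^ 2) ^ r ∂μ) +
            2⁻¹ * (∫⁻ x, (‖A x - a j x‖ₑ ^ 2 + ∑ k ∈ F, ‖a k x‖ₑ ^ 2) ^ r ∂μ) := by
          rw [lintegral_add_left (m1.const_mul _), lintegral_const_mul _ m1, lintegral_const_mul _ m2]
      _ ≤ 2⁻¹ * C + 2⁻¹ * C := by gcongr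
      _ = C := by rw [← add_mul, ENNReal.inv_two_add_inv_two, one_mul]

theorem lintegral_periodize {H : ℝ → ℝ≥0∞} (hH : Measurable H) :
    ∫⁻ s, H s = ∫⁻ τ in Ioc (0:ℝ) 1, ∑' k : ℤ, H (k + τ) := by
  rw [lintegral_tsum (fun k => by fun_prop), ← setLIntegral_univ, ← iUnion_Ioc_intCast ℝ,
    lintegral_iUnion (fun _ => measurableSet_Ioc) (by exact pairwise_disjoint_Ioc_intCast ℝ)]
  refine tsum_congr fun k => ?_
  have e : ∀ τ : ℝ, (Ioc (0:ℝ) 1).indicator (fun τ => H (k + τ)) τ = (Ioc (k:ℝ) (k+1)).indicator H (k + τ) := by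
    intro τ
    by_cases h : τ ∈ Ioc (0:ℝ) 1
    · rw [indicator_of_mem h, indicator_of_mem]
      exact ⟨by linarith [h.1], by linarith [h.2]⟩
    · rw [indicator_of_notMem h, indicator_of_notMem]
      rintro ⟨h1, h2⟩
      exact h ⟨by linarith, by linarith⟩
  rw [← lintegral_indicator measurableSet_Ioc, ← lintegral_indicator measurableSet_Ioc]
  simp_rw [e]
  exact (lintegral_add_left_eq_self _ (k:ℝ)).symm

theorem jensen {X : Type*} [MeasurableSpace X] {μ : Measure X} (hμ : μ univ = 1) {r : ℝ} (hr : 1 < r)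
    {g : X → ℝ≥0∞} (hg : Measurable g) : (∫⁻ x, g x ∂μ) ^ r ≤ ∫⁻ x, g x ^ r ∂μ := by
  have hr0 : 0 < r := by linarith
  have h := ENNReal.lintegral_mul_le_Lp_mul_Lq μ (Real.HolderConjugate.conjExponent hr)
    hg.aemeasurable (aemeasurable_const (b := (1:ℝ≥0∞)))
  simp only [Pi.mul_apply, mul_one, ENNReal.one_rpow, lintegral_const, one_mul, hμ] at h
  have h2 := ENNReal.rpow_le_rpow h hr0.le
  rwa [← ENNReal.rpow_mul, one_div_mul_cancel hr0.ne', ENNReal.rpow_one] at h2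

theorem lintegral_tsum_rpow {X : Type*} [MeasurableSpace X] {μ : Measure X} {r : ℝ} (hr : 0 < r)
    {C : ℝ≥0∞} (g : ℤ → X → ℝ≥0∞) (hg : ∀ k, Measurable (g k))
    (h : ∀ F : Finset ℤ, ∫⁻ x, (∑ k ∈ F, g k x) ^ r ∂μ ≤ C) :
    ∫⁻ x, (∑' k, g k x) ^ r ∂μ ≤ C := by
  have e : ∀ x, (∑' k, g k x) ^ r = ⨆ F : Finset ℤ, (∑ k ∈ F, g k x) ^ r := by
    intro x
    rw [ENNReal.tsum_eq_iSup_sum]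
    exact (ENNReal.orderIsoRpow r hr).map_iSup _
  simp_rw [e]
  rw [lintegral_iSup_directed]
  · exact iSup_le h
  · intro F
    exact Measurable.aemeasurable (by fun_prop)
  · refine Monotone.directed_le fun F G hFG x => ?_
    exact ENNReal.rpow_le_rpow (Finset.sum_le_sum_of_subset hFG) hr.le

end LPproof
end

section
open MeasureTheory Set Metric Filter
open scoped ENNReal NNReal Topology FourierTransform ContDiff

namespace LPproof
variable {E : Type*} [NormedAddCommGroup E] [InnerProductSpace ℝ E] [FiniteDimensional ℝ E]
  [MeasurableSpace E] [BorelSpace E]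

theorem sgn_reflect (φ : E → ℂ) (τ : ℝ) (F : Finset ℤ) (ε : ℤ → ℂ) :
    (fun z => sgn φ τ F ε (-z)) = sgn (fun x => φ (-x)) τ F ε := by
  funext z
  unfold sgn dil
  simp only [smul_neg]

theorem cv_sgn {φ : E → ℂ} {C : ℝ} (h : LPk φ C) (τ : ℝ) (F : Finset ℤ) (ε : ℤ → ℂ) {f : E → ℂ}
    (hf : Integrable f) (x : E) :
    cv f (sgn φ τ F ε) x = ∑ k ∈ F, ε k * cv f (dil φ (Real.exp (k + τ))) x := by
  unfold cv sgn
  simp_rw [Finset.mul_sum]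
  rw [integral_finsetSum]
  · refine Finset.sum_congr rfl fun k _ => ?_
    rw [← integral_const_mul]
    refine integral_congr_ae (Eventually.of_forall fun v => ?_)
    simp only
    ring
  · intro k _
    obtain ⟨B, hB⟩ := dil_bdd h (Real.exp (k + τ))
    refine Integrable.mul_bdd (c := ‖ε k‖ * B) hf ?_ (Eventually.of_forall fun y => ?_)
    · have := continuous_dil h.cont (Real.exp (k + τ))
      exact Continuous.aestronglyMeasurable (by fun_prop)
    · rw [norm_mul]
      gcongr
      exact hB _

theorem sqf_dirac (K f : E → ℂ) (p : ℝ) (x : E) :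
    sqf (Measure.dirac ()) (fun _ : Unit => K) f x ^ (p / 2) = ‖cv f K x‖ₑ ^ p := by
  unfold sqf
  rw [lintegral_dirac, ← ENNReal.rpow_natCast, ← ENNReal.rpow_mul]
  congr 1
  push_cast; ring

theorem sgn_gt_two [Nontrivial E] {φ : E → ℂ} {C0 : ℝ} (h : LPk φ C0) {p : ℝ} (hp : 2 < p) :
    ∃ C : ℝ≥0∞, C ≠ ⊤ ∧ ∀ f : E → ℂ, Continuous f → Integrable f → (∃ B : ℝ, ∀ x, ‖f x‖ ≤ B) →
      ∀ (τ : ℝ) (F : Finset ℤ) (ε : ℤ → ℂ), (∀ k, ‖ε k‖ ≤ 1) →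
      ∫⁻ x, ‖cv f (sgn φ τ F ε) x‖ₑ ^ p ≤ C * ∫⁻ x, ‖f x‖ₑ ^ p := by
  have hpq : p.HolderConjugate (p.conjExponent) := Real.HolderConjugate.conjExponent (by linarith)
  set q := p.conjExponent with hq
  have hq1 : 1 < q := hpq.symm.lt
  have hq2 : q < 2 := by
    rw [hq, Real.conjExponent, div_lt_iff₀ (by linarith)]; linarith
  obtain ⟨A, hA, hczk⟩ := czk_sgn h.reflect
  obtain ⟨C, hC, H⟩ := cz_lt_two (E := E) hq1 hq2 hA
  refine ⟨C ^ (p / q), ENNReal.rpow_ne_top_of_nonneg (by positivity) hC, ?_⟩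
  intro f hfc hf hfB τ F ε hε
  obtain ⟨Bf, hfB⟩ := hfB
  obtain ⟨BK, hKB⟩ := sgn_bdd h τ F ε
  refine duality hpq hp hfc hf hfB (continuous_sgn h τ F ε) (integrable_sgn h τ F ε) hKB ?_
  intro g hgc hg hgB
  have h1 := H Unit (Measure.dirac ()) _ (hczk τ F ε hε) g hgc hg hgB
  simp_rw [sqf_dirac] at h1
  rw [sgn_reflect]
  exact h1

theorem sqf_gt_two [Nontrivial E] {φ : E → ℂ} {C0 : ℝ} (h : LPk φ C0) {p : ℝ} (hp : 2 < p) :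
    ∃ C : ℝ≥0∞, C ≠ ⊤ ∧ ∀ f : E → ℂ, Continuous f → Integrable f → (∃ B : ℝ, ∀ x, ‖f x‖ ≤ B) →
      ∫⁻ x, sqf volume (fun s : ℝ => dil φ (Real.exp s)) f x ^ (p / 2) ≤ C * ∫⁻ x, ‖f x‖ₑ ^ p := by
  obtain ⟨C, hC, H⟩ := sgn_gt_two h hp
  refine ⟨C, hC, fun f hfc hf hfB => ?_⟩
  set Fp := ∫⁻ x, ‖f x‖ₑ ^ p
  have hm : Measurable fun q : ℝ × E => cv f (dil φ (Real.exp q.1)) q.2 :=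
    measurable_cv (K := fun s : ℝ => dil φ (Real.exp s)) (continuous_dil_exp h.cont).measurable hfc.measurable
  have hfin : ∀ τ : ℝ, ∫⁻ x, (∑' k : ℤ, ‖cv f (dil φ (Real.exp (k + τ))) x‖ₑ ^ 2) ^ (p / 2) ≤ C * Fp := by
    intro τ
    have hmk : ∀ k : ℤ, Measurable fun x => cv f (dil φ (Real.exp (k + τ))) x := fun k => by
      obtain ⟨B, hB⟩ := dil_bdd h (Real.exp (k + τ))
      exact (continuous_cv hf (continuous_dil h.cont _) hB).measurable
    refine lintegral_tsum_rpow (by linarith) _ (fun k => (hmk k).enorm.pow_const 2) fun F => ?_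
    have := signs (μ := (volume : Measure E)) (r := p / 2) (C := C * Fp) (by linarith)
      (fun k x => cv f (dil φ (Real.exp (k + τ))) x) hmk F (fun _ => 0) measurable_const ?_
    · simpa using this
    · intro ε hε
      have h1 := H f hfc hf hfB τ F ε (fun k => by rcases hε k with h | h <;> simp [h])
      refine le_trans (le_of_eq ?_) h1
      refine lintegral_congr fun x => ?_
      rw [zero_add, ← cv_sgn h τ F ε hf x, ← ENNReal.rpow_natCast, ← ENNReal.rpow_mul]
      congr 1
      push_cast; ring
  have hm2 : Measurable fun q : E × ℝ => (∑' k : ℤ, ‖cv f (dil φ (Real.exp (k + q.2))) q.1‖ₑ ^ 2) ^ (p / 2) := by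
    refine Measurable.pow_const (Measurable.ennreal_tsum fun k => ?_) _
    exact (hm.comp (by fun_prop : Measurable fun q : E × ℝ => ((k + q.2 : ℝ), q.1))).enorm.pow_const 2
  calc ∫⁻ x, sqf volume (fun s : ℝ => dil φ (Real.exp s)) f x ^ (p / 2)
      ≤ ∫⁻ x, ∫⁻ τ in Ioc (0:ℝ) 1, (∑' k : ℤ, ‖cv f (dil φ (Real.exp (k + τ))) x‖ₑ ^ 2) ^ (p / 2) := by
        refine lintegral_mono fun x => ?_
        have hmx : Measurable fun s : ℝ => ‖cv f (dil φ (Real.exp s)) x‖ₑ ^ 2 :=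
          (hm.comp (by fun_prop : Measurable fun s : ℝ => (s, x))).enorm.pow_const 2
        unfold sqf
        rw [lintegral_periodize hmx]
        refine jensen (by simp) (by linarith) ?_
        exact Measurable.ennreal_tsum fun k => hmx.comp (measurable_const_add _)
    _ = ∫⁻ τ in Ioc (0:ℝ) 1, ∫⁻ x, (∑' k : ℤ, ‖cv f (dil φ (Real.exp (k + τ))) x‖ₑ ^ 2) ^ (p / 2) :=
        lintegral_lintegral_swap hm2.aemeasurable
    _ ≤ ∫⁻ τ in Ioc (0:ℝ) 1, C * Fp := lintegral_mono fun τ => hfin τ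
    _ = C * Fp := by simp

theorem sqf_all [Nontrivial E] {φ : E → ℂ} {C0 : ℝ} (h : LPk φ C0) {p : ℝ} (hp : 1 < p) :
    ∃ C : ℝ≥0∞, C ≠ ⊤ ∧ ∀ f : E → ℂ, Continuous f → Integrable f → (∃ B : ℝ, ∀ x, ‖f x‖ ≤ B) →
      ∫⁻ x, sqf volume (fun s : ℝ => dil φ (Real.exp s)) f x ^ (p / 2) ≤ C * ∫⁻ x, ‖f x‖ₑ ^ p := by
  rcases lt_trichotomy p 2 with h2 | h2 | h2
  · obtain ⟨A, hA, hK⟩ := czk_dil h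
    obtain ⟨C, hC, H⟩ := cz_lt_two (E := E) hp h2 hA
    exact ⟨C, hC, H ℝ volume _ hK⟩
  · obtain ⟨A, hA, hK⟩ := czk_dil h
    refine ⟨A, hA, fun f hfc hf hfB => ?_⟩
    obtain ⟨B, hB⟩ := hfB
    subst h2
    have := l2_sqf hK.meas hK.int hK.four hfc.measurable hf hB
    simpa using this
  · exact sqf_gt_two h h2

theorem subst_exp (g : ℝ → ℝ) :
    ∫⁻ t in Ioi (0:ℝ), ENNReal.ofReal (g t / t) = ∫⁻ s : ℝ, ENNReal.ofReal (g (Real.exp s)) := by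
  have h := lintegral_image_eq_lintegral_abs_deriv_mul (s := univ) (f := Real.exp) (f' := Real.exp)
    MeasurableSet.univ (fun x _ => (Real.hasDerivAt_exp x).hasDerivWithinAt) Real.exp_injective.injOn
    (fun t => ENNReal.ofReal (g t / t))
  rw [image_univ, Real.range_exp, setLIntegral_univ] at h
  rw [h]
  refine lintegral_congr fun s => ?_
  rw [← ENNReal.ofReal_mul (abs_nonneg _), abs_of_pos (Real.exp_pos s)]
  congr 1
  field_simp

end LPproof
end

open MeasureTheory

/-- one-parameter Littlewood–Paley inequality: if `φ` is smooth, has vanishing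
integral, and satisfies `|∂^α φ(x)| ≤ C_α (1+‖x‖)^{-n-1/2-|α|}` for every `α`, then the square
function `G_φ(f)(x) = (∫_0^∞ |f ⋆ φ_t(x)|² dt/t)^{1/2}` is bounded on `L^p` for `1 < p < ∞`. -/
theorem littlewood_paley_one_parameter
    (n : ℕ) (hn : 1 ≤ n) (φ : EuclideanSpace ℝ (Fin n) → ℂ)
    (hsmooth : ContDiff ℝ (⊤ : ℕ∞) φ)
    (hbound : ∀ k : ℕ, ∃ C : ℝ, ∀ x,
      ‖iteratedFDeriv ℝ k φ x‖ ≤ C * (1 + ‖x‖) ^ (-(n : ℝ) - 1/2 - k))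
    (hmean : (∫ x, φ x) = 0) :
    ∀ p : ℝ, 1 < p → ∃ Cp : ℝ,
      ∀ f : SchwartzMap (EuclideanSpace ℝ (Fin n)) ℂ,
        (∫⁻ x, (∫⁻ t in Set.Ioi (0 : ℝ),
            ENNReal.ofReal
              (‖MeasureTheory.convolution (⇑f) (fun y => (t ^ n : ℝ)⁻¹ • φ (t⁻¹ • y))
                  (ContinuousLinearMap.mul ℂ ℂ) volume x‖ ^ 2 / t)) ^ (p / 2)) ^ (1 / p)
          ≤ ENNReal.ofReal Cp * eLpNorm (⇑f) (ENNReal.ofReal p) volume := by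
  intro p hp
  have hp0 : 0 < p := by linarith
  have : Nonempty (Fin n) := ⟨⟨0, hn⟩⟩
  have : Nontrivial (EuclideanSpace ℝ (Fin n)) := inferInstance
  have hfr : Module.finrank ℝ (EuclideanSpace ℝ (Fin n)) = n := finrank_euclideanSpace_fin
  obtain ⟨C0, hC0⟩ := hbound 0
  obtain ⟨C1, hC1⟩ := hbound 1
  obtain ⟨C, hLPk⟩ := LPproof.exists_LPk (φ := φ) (C0 := C0) (C1 := C1) (hsmooth.of_le (by exact_mod_cast le_top))
    (fun x => by
      have := hC0 x
      rw [norm_iteratedFDeriv_zero] at this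
      rw [hfr]
      refine this.trans (le_of_eq ?_)
      congr 2; push_cast; ring)
    (fun x => by
      have := hC1 x
      rw [norm_iteratedFDeriv_one] at this
      rw [hfr]
      refine this.trans (le_of_eq ?_)
      congr 2; push_cast; ring) hmean
  obtain ⟨D, hD, H⟩ := LPproof.sqf_all hLPk hp
  refine ⟨(D ^ (1 / p)).toReal, fun f => ?_⟩
  have hDp : D ^ (1 / p) ≠ ⊤ := ENNReal.rpow_ne_top_of_nonneg (by positivity) hD
  have hfB : ∃ B : ℝ, ∀ x, ‖f x‖ ≤ B := by
    refine ⟨SchwartzMap.seminorm ℝ 0 0 f, fun x => ?_⟩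
    exact f.norm_le_seminorm ℝ x
  have h1 := H f f.continuous f.integrable hfB
  rw [ENNReal.ofReal_toReal hDp, eLpNorm_eq_lintegral_rpow_enorm_toReal (by simpa using hp0) ENNReal.ofReal_ne_top,
    ENNReal.toReal_ofReal hp0.le, ← ENNReal.mul_rpow_of_nonneg _ _ (by positivity)]
  refine ENNReal.rpow_le_rpow (le_trans (le_of_eq ?_) h1) (by positivity)
  refine lintegral_congr fun x => ?_
  congr 1
  rw [LPproof.subst_exp (fun t => ‖MeasureTheory.convolution (⇑f) (fun y => (t ^ n : ℝ)⁻¹ • φ (t⁻¹ • y))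
                  (ContinuousLinearMap.mul ℂ ℂ) volume x‖ ^ 2)]
  unfold LPproof.sqf
  refine lintegral_congr fun s => ?_
  rw [ENNReal.ofReal_pow (norm_nonneg _), ofReal_norm, LPproof.cv_eq]
  have e : (fun y => (Real.exp s ^ n : ℝ)⁻¹ • φ ((Real.exp s)⁻¹ • y)) = LPproof.dil φ (Real.exp s) := by
    funext y
    unfold LPproof.dil
    rw [hfr]
  rw [e]
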